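/- arXiv:0811.1978 — 3 statements merged into one kernel-verified Lean document; each statement's English description precedes it below -/
import Mathlib

section
/- Let X, E, F be complex Banach spaces, Ω ⊂ X open, and g : Ω → Hom(E,F) a function into the space of continuous linear operators with the operator norm. If for every v ∈ E the function x ↦ g(x)v from Ω to F is holomorphic, then g itself is holomorphic as a Hom(E,F)-valued function. -/
open Filter Topology Set
open scoped Nat NNReal ENNReal

/-- If `y ↦ g y v` is differentiable at `x` for every `v`, then its derivative at `x` depends
continuously and linearly on `v`. -/
theorem exists_clm_eq_fderiv_apply {X E F : Type*}
    [NormedAddCommGroup X] [NormedSpace ℂ X]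
    [NormedAddCommGroup E] [NormedSpace ℂ E] [CompleteSpace E]
    [NormedAddCommGroup F] [NormedSpace ℂ F] [CompleteSpace F]
    (g : X → E →L[ℂ] F) (x : X) (h : ∀ v, DifferentiableAt ℂ (fun y => g y v) x) :
    ∃ L : E →L[ℂ] X →L[ℂ] F, ∀ v, L v = fderiv ℂ (fun y => g y v) x := by
  let D : E →ₗ[ℂ] X →L[ℂ] F :=
    { toFun := fun v => fderiv ℂ (fun y => g y v) x
      map_add' := fun v w => by
        simp only [map_add]
        exact fderiv_fun_add (h v) (h w)
      map_smul' := fun c v => by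
        simp only [map_smul, RingHom.id_apply]
        exact fderiv_fun_const_smul (h v) c }
  have hD : ∀ ξ : X, Continuous fun v => D v ξ := by
    intro ξ
    have hc : Tendsto (fun n : ℕ => ‖(n : ℂ)‖) atTop atTop := by
      simpa using tendsto_natCast_atTop_atTop (R := ℝ)
    have hlim : Tendsto
        (fun (n : ℕ) v => ((n : ℂ) • (g (x + (n : ℂ)⁻¹ • ξ) - g x)) v) atTop
        (𝓝 fun v => D v ξ) := by
      rw [tendsto_pi_nhds]
      intro v
      simpa [D] using (h v).hasFDerivAt.lim ξ hc
    exact (continuousLinearMapOfTendsto _ hlim).continuous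
  refine ⟨ContinuousLinearMap.ofSeqClosedGraph (g := D) ?_, fun v => rfl⟩
  intro u v S hu hS
  ext ξ
  refine tendsto_nhds_unique ?_ (((hD ξ).tendsto v).comp hu)
  exact ((ContinuousLinearMap.apply ℂ F ξ).continuous.tendsto S).comp hS

/-- If `x ↦ g x v` is analytic on the open set `Ω` for every `v`, then its iterated derivatives at
points of `Ω` depend continuously and linearly on `v`. -/
theorem exists_clm_eq_iteratedFDeriv_apply {X E F : Type*}
    [NormedAddCommGroup X] [NormedSpace ℂ X]
    [NormedAddCommGroup E] [NormedSpace ℂ E] [CompleteSpace E]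
    [NormedAddCommGroup F] [NormedSpace ℂ F] [CompleteSpace F]
    {Ω : Set X} (hΩ : IsOpen Ω) (g : X → E →L[ℂ] F)
    (h : ∀ v : E, AnalyticOnNhd ℂ (fun x => g x v) Ω) (n : ℕ) :
    ∃ G : X → E →L[ℂ] (X [×n]→L[ℂ] F), ∀ x ∈ Ω, ∀ v,
      G x v = iteratedFDeriv ℂ n (fun y => g y v) x := by
  induction n with
  | zero =>
    refine ⟨fun x => ((continuousMultilinearCurryFin0 ℂ X F).symm :
      F →L[ℂ] (X [×0]→L[ℂ] F)).comp (g x), fun x _ v => ?_⟩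
    rw [iteratedFDeriv_zero_eq_comp]
    rfl
  | succ n ih =>
    obtain ⟨G, hG⟩ := ih
    have hev : ∀ x ∈ Ω, ∀ v,
        (fun y => G y v) =ᶠ[𝓝 x] iteratedFDeriv ℂ n (fun y => g y v) := fun x hx v =>
      eventually_of_mem (hΩ.mem_nhds hx) fun y hy => hG y hy v
    have hL : ∀ x, ∃ L : E →L[ℂ] X →L[ℂ] (X [×n]→L[ℂ] F), x ∈ Ω → ∀ v,
        L v = fderiv ℂ (fun y => G y v) x := by
      intro x
      by_cases hx : x ∈ Ω
      · obtain ⟨L, hL⟩ := exists_clm_eq_fderiv_apply G x fun v =>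
          ((h v).iteratedFDeriv n x hx).differentiableAt.congr_of_eventuallyEq (hev x hx v)
        exact ⟨L, fun _ => hL⟩
      · exact ⟨0, fun hx' => absurd hx' hx⟩
    choose L hL using hL
    refine ⟨fun x => ((continuousMultilinearCurryLeftEquiv ℂ (fun _ : Fin (n + 1) => X) F).symm :
      (X →L[ℂ] (X [×n]→L[ℂ] F)) →L[ℂ] (X [×(n + 1)]→L[ℂ] F)).comp (L x), fun x hx v => ?_⟩
    rw [iteratedFDeriv_succ_eq_comp_left, Function.comp_apply, ← (hev x hx v).fderiv_eq,
      ← hL x hx v]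
    rfl

/-- A uniform boundedness principle for geometric growth: if `‖T n v‖` grows at most
geometrically in `n` for each `v`, then so does `‖T n‖`. -/
theorem exists_opNorm_le_mul_pow {E : Type*} {H : ℕ → Type*}
    [NormedAddCommGroup E] [NormedSpace ℂ E] [CompleteSpace E]
    [∀ n, NormedAddCommGroup (H n)] [∀ n, NormedSpace ℂ (H n)]
    (T : ∀ n, E →L[ℂ] H n) (h : ∀ v, ∃ k : ℕ, ∀ n, ‖T n v‖ ≤ (k : ℝ) ^ (n + 1)) :
    ∃ (C : ℝ) (k : ℕ), ∀ n, ‖T n‖ ≤ C * (k : ℝ) ^ n := by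
  obtain ⟨k, v₀, hv₀⟩ := nonempty_interior_of_iUnion_of_closed
    (f := fun k : ℕ => ⋂ n, {v : E | ‖T n v‖ ≤ (k : ℝ) ^ (n + 1)})
    (fun k => isClosed_iInter fun n => isClosed_le (T n).continuous.norm continuous_const)
    (by
      ext v
      simpa using h v)
  rw [mem_interior_iff_mem_nhds, Metric.nhds_basis_closedBall.mem_iff] at hv₀
  obtain ⟨ε, hε, hball⟩ := hv₀
  have hk : ∀ w : E, ‖w‖ ≤ ε → ∀ n, ‖T n (v₀ + w)‖ ≤ (k : ℝ) ^ (n + 1) := by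
    intro w hw n
    exact mem_iInter.1 (hball (by simpa using hw)) n
  refine ⟨2 * k / ε, k, fun n => ContinuousLinearMap.opNorm_le_bound _ (by positivity) fun v => ?_⟩
  rcases eq_or_ne v 0 with rfl | hv
  · simp
  have hv' : 0 < ‖v‖ := norm_pos_iff.2 hv
  set c : ℂ := ((ε / ‖v‖ : ℝ) : ℂ) with hc
  have hcn : ‖c‖ = ε / ‖v‖ := by
    rw [hc, Complex.norm_real, Real.norm_of_nonneg (by positivity)]
  have hcv : ‖c • v‖ ≤ ε := by
    rw [norm_smul, hcn, div_mul_cancel₀ _ hv'.ne']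
  have hT : ‖T n (c • v)‖ ≤ 2 * (k : ℝ) ^ (n + 1) := by
    have h₁ := hk _ hcv n
    have h₀ := hk 0 (by simpa using hε.le) n
    have : T n (c • v) = T n (v₀ + c • v) - T n (v₀ + 0) := by simp
    rw [this]
    linarith [norm_sub_le (T n (v₀ + c • v)) (T n (v₀ + 0))]
  rw [map_smul, norm_smul, hcn, div_mul_eq_mul_div, div_le_iff₀ hv'] at hT
  rw [div_mul_eq_mul_div, div_mul_eq_mul_div, le_div_iff₀ hε]
  calc ‖T n v‖ * ε = ε * ‖T n v‖ := mul_comm _ _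
    _ ≤ _ := hT
    _ = _ := by ring

/-- The Taylor coefficients of an analytic function grow at most geometrically. -/
theorem AnalyticAt.exists_norm_iteratedFDeriv_le {X F : Type*}
    [NormedAddCommGroup X] [NormedSpace ℂ X]
    [NormedAddCommGroup F] [NormedSpace ℂ F] [CompleteSpace F]
    {f : X → F} {x : X} (hf : AnalyticAt ℂ f x) :
    ∃ k : ℕ, ∀ n, ‖(n ! : ℂ)⁻¹ • iteratedFDeriv ℂ n f x‖ ≤ (k : ℝ) ^ (n + 1) := by
  obtain ⟨p, R, hp⟩ := hf
  obtain ⟨r, hr₀, hr⟩ := ENNReal.lt_iff_exists_nnreal_btwn.1 (hp.r_pos.trans_le hp.r_le)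
  have hr₀ : 0 < r := by exact_mod_cast hr₀
  obtain ⟨C, hC, hpC⟩ := p.norm_le_div_pow_of_pos_of_lt_radius hr₀ hr
  obtain ⟨k, hk⟩ := exists_nat_ge (max C (r : ℝ)⁻¹)
  refine ⟨k, fun n => ?_⟩
  have hD : ‖iteratedFDeriv ℂ n f x‖ ≤ n ! * ‖p n‖ := by
    refine ContinuousMultilinearMap.opNorm_le_bound (by positivity) fun m => ?_
    rw [hp.iteratedFDeriv_eq_sum_of_completeSpace]
    calc ‖∑ σ : Equiv.Perm (Fin n), p n fun i => m (σ i)‖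
        ≤ ∑ σ : Equiv.Perm (Fin n), ‖p n‖ * ∏ i, ‖m i‖ := by
          refine norm_sum_le_of_le _ fun σ _ => ?_
          rw [← Equiv.prod_comp σ fun i => ‖m i‖]
          exact (p n).le_opNorm _
      _ = n ! * ‖p n‖ * ∏ i, ‖m i‖ := by
          simp [Fintype.card_perm, mul_assoc]
  have hn : (0 : ℝ) < n ! := by positivity
  calc ‖(n ! : ℂ)⁻¹ • iteratedFDeriv ℂ n f x‖
      = (n ! : ℝ)⁻¹ * ‖iteratedFDeriv ℂ n f x‖ := by simp [norm_smul]
    _ ≤ (n ! : ℝ)⁻¹ * (n ! * ‖p n‖) := by gcongr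
    _ = ‖p n‖ := by field_simp
    _ ≤ C * (r : ℝ)⁻¹ ^ n := by simpa [div_eq_mul_inv] using hpC n
    _ ≤ k * (k : ℝ) ^ n := by
        gcongr
        · exact (le_max_left _ _).trans hk
        · exact (le_max_right _ _).trans hk
    _ = (k : ℝ) ^ (n + 1) := by ring

/-- If `g : Ω → Hom(E,F)` is such that `x ↦ g x v` is holomorphic on the open
set `Ω` for every `v ∈ E`, then `g` is holomorphic as an operator-valued function. -/
theorem analyticOnNhd_of_apply_analyticOnNhd
    (X E F : Type*) [NormedAddCommGroup X] [NormedSpace ℂ X] [CompleteSpace X]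
    [NormedAddCommGroup E] [NormedSpace ℂ E] [CompleteSpace E]
    [NormedAddCommGroup F] [NormedSpace ℂ F] [CompleteSpace F]
    (Ω : Set X) (hΩ : IsOpen Ω) (g : X → E →L[ℂ] F)
    (h : ∀ v : E, AnalyticOnNhd ℂ (fun x => g x v) Ω) :
    AnalyticOnNhd ℂ g Ω := by
  intro x hx
  choose G hG using exists_clm_eq_iteratedFDeriv_apply hΩ g h
  let T : ∀ n, E →L[ℂ] (X [×n]→L[ℂ] F) := fun n => (n ! : ℂ)⁻¹ • G n x
  have hT : ∀ n v, T n v = (n ! : ℂ)⁻¹ • iteratedFDeriv ℂ n (fun y => g y v) x := fun n v => by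
    simp [T, hG n x hx v]
  obtain ⟨C, k, hC⟩ := exists_opNorm_le_mul_pow T fun v => by
    simpa only [hT] using (h v x hx).exists_norm_iteratedFDeriv_le
  let q : FormalMultilinearSeries ℂ X (E →L[ℂ] F) := fun n => (T n).flipMultilinear
  have hq : ∀ n, ‖q n‖ ≤ C * (k : ℝ) ^ n := fun n =>
    (MultilinearMap.mkContinuous_norm_le _ (norm_nonneg _) _).trans (hC n)
  have hC₀ : 0 ≤ C := by simpa using (norm_nonneg (q 0)).trans (hq 0)
  have hrad : 0 < q.radius := by
    have hk : (0 : ℝ) < k + 1 := by positivity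
    refine lt_of_lt_of_le ?_ (q.le_radius_of_bound C (r := (k + 1 : ℝ≥0)⁻¹) fun n => ?_)
    · simp
    · push_cast
      rw [inv_pow, ← div_eq_mul_inv, div_le_iff₀ (by positivity)]
      refine (hq n).trans ?_
      gcongr
      linarith
  have hsum : HasFPowerSeriesOnBall (fun y => q.sum (y - x)) q x q.radius := by
    simpa using (q.hasFPowerSeriesOnBall hrad).comp_sub x
  obtain ⟨ε, hε, hεΩ, hεq⟩ : ∃ ε > 0, Metric.ball x ε ⊆ Ω ∧
      Metric.ball x ε ⊆ Metric.eball x q.radius := by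
    obtain ⟨ε, hε, hsub⟩ := Metric.mem_nhds_iff.1
      (inter_mem (hΩ.mem_nhds hx) (Metric.eball_mem_nhds x hrad))
    exact ⟨ε, hε, hsub.trans inter_subset_left, hsub.trans inter_subset_right⟩
  have heq : ∀ v, EqOn (fun y => g y v) (fun y => q.sum (y - x) v) (Metric.ball x ε) := by
    intro v
    refine ((h v).mono hεΩ).eqOn_of_preconnected_of_eventuallyEq
      (((ContinuousLinearMap.apply ℂ F v).comp_analyticOnNhd hsum.analyticOnNhd).mono hεq)
      (convex_ball x ε).isPreconnected (Metric.mem_ball_self hε) ?_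
    obtain ⟨p, r, hp⟩ := h v x hx
    filter_upwards [Metric.eball_mem_nhds x hp.r_pos, Metric.eball_mem_nhds x hrad] with y hyr hyq
    have hg := hp.hasSum_iteratedFDeriv (y := y - x)
      (by simpa [edist_eq_enorm_sub] using hyr)
    have hs := (ContinuousLinearMap.apply ℂ F v).hasSum (hsum.hasSum_sub hyq)
    rw [add_sub_cancel] at hg
    refine hg.unique ?_
    convert! hs using 2 with n
    simp [q, hT]
  refine hsum.analyticAt.congr ?_
  filter_upwards [Metric.ball_mem_nhds x hε] with y hy
  ext v
  exact (heq v hy).symm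
end

section
/- Every O_ζ-module homomorphism φ : O^E_ζ → O^F_ζ between plain modules at a point ζ ∈ ℂ^m with 1 ≤ m < ∞ is plain, i.e., there exists a germ Φ ∈ O^{Hom(E,F)}_ζ of a holomorphic Hom(E,F)-valued function near ζ such that φ(e) is the germ of z ↦ Φ(z)e(z) for every e ∈ O^E_ζ. -/
open Filter Topology

/-- The value at `a` of a germ at `a` (well defined since every neighborhood contains `a`). -/
noncomputable def germValue {α β : Type*} [TopologicalSpace α] (a : α) :
    Filter.Germ (𝓝 a) β → β :=
  fun g => g.liftOn (fun f => f a) (fun _ _ h => h.self_of_nhds)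

variable (X : Type*) [NormedAddCommGroup X] [NormedSpace ℂ X]

/-- The local ring `O_ζ` of scalar holomorphic germs at `ζ`. -/
noncomputable def Oat (ζ : X) : Subring (Filter.Germ (𝓝 ζ) ℂ) where
  carrier := {g | ∃ f : X → ℂ, AnalyticAt ℂ f ζ ∧ g = ↑f}
  mul_mem' := by
    rintro a b ⟨f, hf, rfl⟩ ⟨k, hk, rfl⟩
    exact ⟨f * k, hf.mul hk, rfl⟩
  one_mem' := ⟨fun _ => 1, analyticAt_const, rfl⟩
  add_mem' := by
    rintro a b ⟨f, hf, rfl⟩ ⟨k, hk, rfl⟩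
    exact ⟨f + k, hf.add hk, rfl⟩
  zero_mem' := ⟨fun _ => 0, analyticAt_const, rfl⟩
  neg_mem' := by
    rintro a ⟨f, hf, rfl⟩
    exact ⟨-f, hf.neg, rfl⟩

noncomputable instance (ζ : X) (M : Type*) [AddCommGroup M]
    [Module (Filter.Germ (𝓝 ζ) ℂ) M] : Module (Oat X ζ) M :=
  Module.compHom M (Oat X ζ).subtype

variable (E : Type*) [NormedAddCommGroup E] [NormedSpace ℂ E]

/-- The `O_ζ`-module `O^E_ζ` of `E`-valued holomorphic germs at `ζ` (a "plain module"). -/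
noncomputable def OEat (ζ : X) : Submodule (Oat X ζ) (Filter.Germ (𝓝 ζ) E) where
  carrier := {g | ∃ f : X → E, AnalyticAt ℂ f ζ ∧ g = ↑f}
  add_mem' := by
    rintro a b ⟨f, hf, rfl⟩ ⟨k, hk, rfl⟩
    exact ⟨f + k, hf.add hk, rfl⟩
  zero_mem' := ⟨fun _ => 0, analyticAt_const, rfl⟩
  smul_mem' := by
    rintro ⟨c, a, ha, rfl⟩ x ⟨f, hf, rfl⟩
    exact ⟨fun z => a z • f z, ha.smul hf, rfl⟩

/-- The germ at `ζ` of a function analytic at `ζ`, as an element of `O^E_ζ`. -/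
noncomputable def germOf (ζ : X) (f : X → E) (hf : AnalyticAt ℂ f ζ) : OEat X E ζ :=
  ⟨(↑f : Filter.Germ (𝓝 ζ) E), f, hf, rfl⟩

/-- The constant germ at `ζ` with value `v`. -/
noncomputable def constGerm (ζ : X) (v : E) : OEat X E ζ :=
  germOf X E ζ (fun _ => v) analyticAt_const

/-- Evaluation at `ζ` as a ring homomorphism `O_ζ → ℂ`. -/
noncomputable def evalAt (ζ : X) : Oat X ζ →+* ℂ where
  toFun g := germValue ζ (g : Filter.Germ (𝓝 ζ) ℂ)
  map_one' := rfl
  map_mul' := by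
    rintro ⟨a, _⟩ ⟨b, _⟩
    induction a using Filter.Germ.inductionOn
    induction b using Filter.Germ.inductionOn
    rfl
  map_zero' := rfl
  map_add' := by
    rintro ⟨a, _⟩ ⟨b, _⟩
    induction a using Filter.Germ.inductionOn
    induction b using Filter.Germ.inductionOn
    rfl

/-- The maximal ideal `m_ζ ⊂ O_ζ` of germs vanishing at `ζ`. -/
noncomputable def mIdeal (ζ : X) : Ideal (Oat X ζ) := RingHom.ker (evalAt X ζ)

/-- Positivity of the `I`-depth of a module `M`: either `M = IM` (depth `+∞` by convention),
or there is a nonzerodivisor `r ∈ I` on `M` with `rM ≠ M`. -/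
def IsDepthPos (R : Type*) [CommRing R] (I : Ideal R) (M : Type*) [AddCommGroup M]
    [Module R M] : Prop :=
  (I • (⊤ : Submodule R M) = ⊤) ∨
    ∃ r ∈ I, (∀ x : M, r • x = 0 → x = 0) ∧ Ideal.span {r} • (⊤ : Submodule R M) ≠ ⊤

section Coefficients

variable {Z V W : Type*} [NormedAddCommGroup Z] [NormedSpace ℂ Z]
  [NormedAddCommGroup V] [NormedSpace ℂ V] [NormedAddCommGroup W] [NormedSpace ℂ W]

/-- Course-of-values recursion: a sequence may be prescribed in terms of its earlier terms. -/
lemma exists_seq_eq_of_initial_segment {α : Type*} (P : ∀ n : ℕ, (Fin n → α) → α) :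
    ∃ e : ℕ → α, ∀ n, e n = P n fun i => e i :=
  ⟨wellFounded_lt.fix fun n u => P n fun i => u i i.2, fun n => WellFounded.fix_eq _ _ n⟩

lemma LinearMap.exists_lt_norm_of_not_continuous {T : V →ₗ[ℂ] W} (hT : ¬ Continuous T) (M : ℝ) :
    ∃ v : V, ‖v‖ ≤ 1 ∧ M < ‖T v‖ := by
  contrapose! hT
  obtain ⟨C, hC⟩ := T.bound_of_ball_bound one_pos M fun z hz => hT z (mem_ball_zero_iff.1 hz).le
  exact AddMonoidHomClass.continuous_of_bound T C hC

/-- If the Cauchy product of a sequence of linear maps with every bounded sequence grows at most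
geometrically, then all the maps are continuous. -/
lemma continuous_of_cauchyProduct_bound (T : ℕ → V →ₗ[ℂ] W)
    (H : ∀ e : ℕ → V, (∀ j, ‖e j‖ ≤ 1) → ∃ N : ℕ, ∀ n,
      ‖∑ j ∈ Finset.range (n + 1), T (n - j) (e j)‖ ≤ (N : ℝ) ^ (n + 1)) (k : ℕ) :
    Continuous (T k) := by
  induction k using Nat.strong_induction_on with
  | _ k ih =>
  by_contra hk
  choose G hG1 hG using LinearMap.exists_lt_norm_of_not_continuous hk
  have hC : ∀ i : ℕ, ∃ C : ℝ, i < k → ∀ v : V, ‖v‖ ≤ 1 → ‖T i v‖ ≤ C := by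
    intro i
    by_cases hi : i < k
    · refine ⟨‖(⟨T i, ih i hi⟩ : V →L[ℂ] W)‖, fun _ v hv => ?_⟩
      exact (⟨T i, ih i hi⟩ : V →L[ℂ] W).unit_le_opNorm v hv
    · exact ⟨0, fun h => absurd h hi⟩
  choose C hC using hC
  obtain ⟨e, he⟩ := exists_seq_eq_of_initial_segment (α := V) fun n u =>
    G ((n : ℝ) ^ (n + k + 1) + ‖∑ i : Fin n, T (n + k - i) (u i)‖
      + ∑ i ∈ Finset.range k, C (k - (i + 1)))
  have he1 : ∀ j, ‖e j‖ ≤ 1 := fun j => by rw [he]; exact hG1 _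
  obtain ⟨N, hN⟩ := H e he1
  have hNk := hN (N + k)
  have hbig := hG ((N : ℝ) ^ (N + k + 1) + ‖∑ i : Fin N, T (N + k - i) (e i)‖
      + ∑ i ∈ Finset.range k, C (k - (i + 1)))
  rw [← he N, Fin.sum_univ_eq_sum_range (fun i => T (N + k - i) (e i))] at hbig
  rw [add_assoc N k 1, Finset.sum_range_add, Finset.sum_range_succ'] at hNk
  have htail : ‖∑ i ∈ Finset.range k, T (N + k - (N + (i + 1))) (e (N + (i + 1)))‖
      ≤ ∑ i ∈ Finset.range k, C (k - (i + 1)) := by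
    refine norm_sum_le_of_le _ fun i hi => ?_
    rw [Nat.add_sub_add_left]
    have := Finset.mem_range.1 hi
    exact hC _ (by omega) _ (he1 _)
  simp only [add_zero, Nat.add_sub_cancel_left] at hNk
  set a := ∑ i ∈ Finset.range N, T (N + k - i) (e i)
  set b := ∑ i ∈ Finset.range k, T (N + k - (N + (i + 1))) (e (N + (i + 1)))
  have htri : ‖T k (e N)‖ ≤ ‖a + (b + T k (e N))‖ + ‖a‖ + ‖b‖ := by
    have h : T k (e N) = (a + (b + T k (e N))) - a - b := by abel
    calc ‖T k (e N)‖ = ‖(a + (b + T k (e N))) - a - b‖ := by rw [← h]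
      _ ≤ _ := (norm_sub_le _ _).trans (by gcongr; exact norm_sub_le _ _)
  rw [← add_assoc N k 1] at hNk
  linarith

/-- Uniform boundedness with geometric growth. -/
lemma exists_norm_le_mul_pow_of_pointwise [CompleteSpace V] {G : ℕ → Type*}
    [∀ n, NormedAddCommGroup (G n)] [∀ n, NormedSpace ℂ (G n)] (D : ∀ n, V →L[ℂ] G n)
    (h : ∀ v, ∃ N : ℕ, ∀ n, ‖D n v‖ ≤ (N : ℝ) ^ (n + 1)) :
    ∃ C r : ℝ, 0 ≤ C ∧ 0 < r ∧ ∀ n, ‖D n‖ ≤ C * r ^ n := by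
  have hclosed : ∀ N : ℕ, IsClosed {v : V | ∀ n, ‖D n v‖ ≤ (N : ℝ) ^ (n + 1)} := fun N => by
    simp only [Set.ofPred_forall]
    exact isClosed_iInter fun n => isClosed_le (D n).continuous.norm continuous_const
  obtain ⟨N, v₀, hv₀⟩ := nonempty_interior_of_iUnion_of_closed hclosed
    (Set.eq_univ_of_forall fun v => Set.mem_iUnion.2 (h v))
  obtain ⟨ε, hε, hball⟩ := Metric.mem_nhds_iff.1 (mem_interior_iff_mem_nhds.1 hv₀)
  refine ⟨4 * (N + 1) / ε, N + 1, by positivity, by positivity, fun n => ?_⟩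
  refine ContinuousLinearMap.opNorm_le_of_shell hε (by positivity) (c := (2 : ℂ)) (by simp)
    fun x hx1 hx2 => ?_
  have h1 := hball (show v₀ + x ∈ Metric.ball v₀ ε by simpa using hx2) n
  have h2 := hball (Metric.mem_ball_self hε) n
  have hx : 1 ≤ 2 / ε * ‖x‖ := by
    simp only [Complex.norm_ofNat] at hx1
    rw [div_mul_eq_mul_div, le_div_iff₀ hε]
    linarith
  have hN : (N : ℝ) ^ (n + 1) ≤ (N + 1 : ℝ) ^ (n + 1) := by gcongr; linarith
  calc ‖D n x‖ = ‖D n (v₀ + x) - D n v₀‖ := by simp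
    _ ≤ (N : ℝ) ^ (n + 1) + (N : ℝ) ^ (n + 1) := (norm_sub_le _ _).trans (add_le_add h1 h2)
    _ ≤ 2 * (N + 1 : ℝ) ^ (n + 1) * 1 := by linarith
    _ ≤ 2 * (N + 1 : ℝ) ^ (n + 1) * (2 / ε * ‖x‖) := by gcongr
    _ = 4 * (N + 1) / ε * (N + 1) ^ n * ‖x‖ := by ring

lemma hasFPowerSeriesAt_zero_of_hasSum_pow_smul {f : ℂ → W} {c : ℕ → W}
    (hc : ∀ᶠ t in 𝓝 (0 : ℂ), HasSum (fun n => t ^ n • c n) (f t)) :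
    ∃ p : FormalMultilinearSeries ℂ ℂ W, HasFPowerSeriesAt f p 0 ∧ ∀ n, p.coeff n = c n := by
  let p : FormalMultilinearSeries ℂ ℂ W := fun n =>
    ContinuousMultilinearMap.mkPiRing ℂ (Fin n) (c n)
  have hp : ∀ n, p.coeff n = c n := fun n => by simp [p, FormalMultilinearSeries.coeff]
  refine ⟨p, ?_, hp⟩
  rw [hasFPowerSeriesAt_iff]
  simpa [hp] using hc

/-- The coefficients of a power series in one variable are unique. -/
lemma coeff_unique {f : ℂ → W} {a b : ℕ → W}
    (ha : ∀ᶠ t in 𝓝 (0 : ℂ), HasSum (fun n => t ^ n • a n) (f t))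
    (hb : ∀ᶠ t in 𝓝 (0 : ℂ), HasSum (fun n => t ^ n • b n) (f t)) : a = b := by
  obtain ⟨p, hp, hpa⟩ := hasFPowerSeriesAt_zero_of_hasSum_pow_smul ha
  obtain ⟨q, hq, hqb⟩ := hasFPowerSeriesAt_zero_of_hasSum_pow_smul hb
  funext n
  rw [← hpa, ← hqb, hp.eq_formalMultilinearSeries hq]

/-- A power series with bounded coefficients is analytic at the origin. -/
lemma analyticAt_tsum_pow_smul [CompleteSpace W] {e : ℕ → W} (he : ∀ j, ‖e j‖ ≤ 1) :
    AnalyticAt ℂ (fun t : ℂ => ∑' i, t ^ i • e i) 0 ∧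
      ∀ᶠ t in 𝓝 (0 : ℂ), HasSum (fun i => t ^ i • e i) (∑' i, t ^ i • e i) := by
  have hsum : ∀ᶠ t in 𝓝 (0 : ℂ), HasSum (fun i => t ^ i • e i) (∑' i, t ^ i • e i) := by
    filter_upwards [Metric.ball_mem_nhds (0 : ℂ) one_pos] with t ht
    refine (Summable.of_norm_bounded
      (summable_geometric_of_lt_one (norm_nonneg t) (by simpa using ht)) fun i => ?_).hasSum
    rw [norm_smul, norm_pow]
    exact mul_le_of_le_one_right (by positivity) (he i)
  obtain ⟨p, hp, -⟩ := hasFPowerSeriesAt_zero_of_hasSum_pow_smul hsum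
  exact ⟨hp.analyticAt, hsum⟩

/-- The `n`-th homogeneous Taylor term of `h` at `ζ`, as a symmetric multilinear map. -/
noncomputable def taylorTerm (ζ : Z) (h : Z → W) (n : ℕ) : Z [×n]→L[ℂ] W :=
  (n.factorial : ℂ)⁻¹ • iteratedFDeriv ℂ n h ζ

lemma taylorTerm_congr {ζ : Z} {h k : Z → W} (hk : h =ᶠ[𝓝 ζ] k) (n : ℕ) :
    taylorTerm ζ h n = taylorTerm ζ k n := by
  rw [taylorTerm, taylorTerm, (hk.iteratedFDeriv ℂ n).self_of_nhds]

variable [CompleteSpace W]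

lemma eventually_hasSum_taylorTerm {ζ : Z} {h : Z → W} (hh : AnalyticAt ℂ h ζ) :
    ∀ᶠ y in 𝓝 (0 : Z), HasSum (fun n => taylorTerm ζ h n fun _ => y) (h (ζ + y)) := by
  obtain ⟨p, r, hp⟩ := hh
  filter_upwards [Metric.eball_mem_nhds (0 : Z) hp.r_pos] with y hy
  exact hp.hasSum_iteratedFDeriv hy

lemma eventually_hasSum_taylorTerm_line {ζ : Z} {h : Z → W} (hh : AnalyticAt ℂ h ζ) (w : Z) :
    ∀ᶠ t in 𝓝 (0 : ℂ), HasSum (fun n => t ^ n • taylorTerm ζ h n fun _ => w) (h (ζ + t • w)) := by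
  have hc : Tendsto (fun t : ℂ => t • w) (𝓝 0) (𝓝 0) := by
    have hcont : Continuous fun t : ℂ => t • w := by fun_prop
    simpa using hcont.tendsto 0
  filter_upwards [hc.eventually (eventually_hasSum_taylorTerm hh)] with t ht
  convert! ht using 2 with n
  simpa using ((taylorTerm ζ h n).map_smul_univ (fun _ => t) fun _ => w).symm

lemma exists_norm_taylorTerm_le {ζ : Z} {h : Z → W} (hh : AnalyticAt ℂ h ζ) :
    ∃ N : ℕ, ∀ n, ‖taylorTerm ζ h n‖ ≤ (N : ℝ) ^ (n + 1) := by
  obtain ⟨p, r, hp⟩ := hh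
  obtain ⟨C, ρ, hC, hρ, hb⟩ := p.le_mul_pow_of_radius_pos (hp.r_pos.trans_le hp.r_le)
  obtain ⟨N, hN⟩ := exists_nat_ge (max C ρ)
  refine ⟨N, fun n => ?_⟩
  have hpn : ‖taylorTerm ζ h n‖ ≤ ‖p n‖ := by
    refine ContinuousMultilinearMap.opNorm_le_bound (norm_nonneg _) fun v => ?_
    have hs : ‖iteratedFDeriv ℂ n h ζ v‖ ≤ n.factorial * (‖p n‖ * ∏ i, ‖v i‖) := by
      rw [hp.iteratedFDeriv_eq_sum_of_completeSpace]
      refine (norm_sum_le_of_le (f := fun σ : Equiv.Perm (Fin n) => p n fun i => v (σ i))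
        (n := fun _ => ‖p n‖ * ∏ i, ‖v i‖) _ fun σ _ => ?_).trans
        (by simp [Fintype.card_perm])
      refine ((p n).le_opNorm _).trans_eq ?_
      rw [Equiv.prod_comp σ fun i => ‖v i‖]
    have hf : (0 : ℝ) < n.factorial := by exact_mod_cast n.factorial_pos
    rw [taylorTerm, smul_apply, norm_smul, norm_inv, Complex.norm_natCast,
      inv_mul_le_iff₀ hf]
    exact hs
  calc ‖taylorTerm ζ h n‖ ≤ C * ρ ^ n := hpn.trans (hb n)
    _ ≤ N * (N : ℝ) ^ n := by
      gcongr
      exacts [(le_max_left _ _).trans hN, (le_max_right _ _).trans hN]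
    _ = _ := by ring

lemma taylorTerm_add {ζ : Z} {h k : Z → W} (hh : AnalyticAt ℂ h ζ) (hk : AnalyticAt ℂ k ζ)
    (n : ℕ) : taylorTerm ζ (h + k) n = taylorTerm ζ h n + taylorTerm ζ k n := by
  simp only [taylorTerm]
  rw [iteratedFDeriv_add_apply hh.contDiffAt hk.contDiffAt, smul_add]

lemma taylorTerm_const_smul {ζ : Z} {h : Z → W} (hh : AnalyticAt ℂ h ζ) (c : ℂ) (n : ℕ) :
    taylorTerm ζ (c • h) n = c • taylorTerm ζ h n := by
  simp only [taylorTerm]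
  rw [iteratedFDeriv_const_smul_apply hh.contDiffAt, smul_comm]

/-- Polarization: a symmetric multilinear map with the same diagonal as a Taylor term is equal
to it. -/
lemma eq_taylorTerm_of_diagonal {ζ : Z} {h : Z → W} (hh : AnalyticAt ℂ h ζ) {n : ℕ}
    {Q : Z [×n]→L[ℂ] W} (hsymm : ∀ (v : Fin n → Z) (σ : Equiv.Perm (Fin n)), Q (v ∘ σ) = Q v)
    (hdiag : ∀ w, Q (fun _ => w) = taylorTerm ζ h n fun _ => w) : Q = taylorTerm ζ h n := by
  have hT : ∀ (v : Fin n → Z) (σ : Equiv.Perm (Fin n)),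
      taylorTerm ζ h n (v ∘ σ) = taylorTerm ζ h n v := fun v σ => by
    simp only [taylorTerm, smul_apply]
    rw [hh.contDiffAt.iteratedFDeriv_comp_perm]
  ext v
  have h1 := ContinuousMultilinearMap.iteratedFDeriv_comp_diagonal Q 0 v
  have h2 := ContinuousMultilinearMap.iteratedFDeriv_comp_diagonal (taylorTerm ζ h n) 0 v
  rw [funext hdiag, h2] at h1
  simp only [← Function.comp_def, hT, hsymm, Finset.sum_const, Finset.card_univ,
    ← Nat.cast_smul_eq_nsmul ℂ] at h1
  exact (smul_right_injective W (r := ((Fintype.card (Equiv.Perm (Fin n)) : ℕ) : ℂ))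
    (by exact_mod_cast Fintype.card_ne_zero) h1).symm

end Coefficients

section GermHom

variable {Z V W : Type*} [NormedAddCommGroup Z] [NormedSpace ℂ Z]
  [NormedAddCommGroup V] [NormedSpace ℂ V] [NormedAddCommGroup W] [NormedSpace ℂ W]

/-- `A` induces an `O_ζ`-linear map from `V`-valued to `W`-valued holomorphic germs at `ζ`. -/
structure IsGermHom (ζ : Z) (A : (Z → V) → Z → W) : Prop where
  analyticAt {f : Z → V} : AnalyticAt ℂ f ζ → AnalyticAt ℂ (A f) ζ
  congr {f g : Z → V} : AnalyticAt ℂ f ζ → f =ᶠ[𝓝 ζ] g → A f =ᶠ[𝓝 ζ] A g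
  add {f g : Z → V} : AnalyticAt ℂ f ζ → AnalyticAt ℂ g ζ → A (f + g) =ᶠ[𝓝 ζ] A f + A g
  smul {a : Z → ℂ} {f : Z → V} : AnalyticAt ℂ a ζ → AnalyticAt ℂ f ζ →
    A (a • f) =ᶠ[𝓝 ζ] a • A f

lemma AnalyticAt.clm_apply {ζ : Z} {Φ : Z → V →L[ℂ] W} {f : Z → V} (hΦ : AnalyticAt ℂ Φ ζ)
    (hf : AnalyticAt ℂ f ζ) : AnalyticAt ℂ (fun z => Φ z (f z)) ζ :=
  ((ContinuousLinearMap.id ℂ (V →L[ℂ] W)).analyticAt_bilinear (Φ ζ, f ζ)).comp₂ hΦ hf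

/-- First-order Taylor expansion with analytic remainder. -/
lemma AnalyticAt.exists_eq_add_apply_sub [CompleteSpace V] {ζ : Z} {f : Z → V}
    (hf : AnalyticAt ℂ f ζ) :
    ∃ q : Z → Z →L[ℂ] V, AnalyticAt ℂ q ζ ∧ f =ᶠ[𝓝 ζ] fun z => f ζ + q z (z - ζ) := by
  obtain ⟨p, r, hp⟩ := hf
  have hr : 0 < p.shift.radius := by
    rw [FormalMultilinearSeries.radius_shift]; exact hp.r_pos.trans_le hp.r_le
  have hq : HasFPowerSeriesOnBall (fun z => p.shift.sum (z - ζ)) p.shift ζ p.shift.radius := by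
    simpa using (p.shift.hasFPowerSeriesOnBall hr).comp_sub ζ
  refine ⟨_, hq.analyticAt, ?_⟩
  have h := (hq.unshift (z := f ζ)).hasFPowerSeriesAt
  have hpu : p.shift.unshift (f ζ) = p := by
    ext n v
    cases n with
    | zero =>
      simpa [FormalMultilinearSeries.unshift, Subsingleton.elim v 0] using
        (hp.coeff_zero v).symm
    | succ n =>
      simp [FormalMultilinearSeries.unshift, FormalMultilinearSeries.shift]
  rw [hpu] at h
  filter_upwards [hp.hasFPowerSeriesAt.eventually_hasSum_sub, h.eventually_hasSum_sub]
    with z hz hz'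
  exact hz.unique hz'

/-- An analytic function vanishing to infinite order vanishes near the point. -/
lemma AnalyticAt.eventuallyEq_zero_of_isBigO {ζ : Z} {h : Z → W} (hh : AnalyticAt ℂ h ζ)
    (hO : ∀ n : ℕ, h =O[𝓝 ζ] fun z => ‖z - ζ‖ ^ n) : h =ᶠ[𝓝 ζ] 0 := by
  obtain ⟨p, hp⟩ := hh
  have hc : Tendsto (fun y => ζ + y) (𝓝 0) (𝓝 ζ) := by
    have hcont : Continuous fun y : Z => ζ + y := by fun_prop
    simpa using hcont.tendsto 0
  have hzero : ∀ (n : ℕ) (y : Z), (p n fun _ => y) = 0 := by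
    intro n
    induction n using Nat.strong_induction_on with
    | _ k hk =>
    have psum_eq : p.partialSum (k + 1) = fun y => p k fun _ => y := by
      funext z
      refine Finset.sum_eq_single _ (fun b hb hnb => ?_) fun hn => ?_
      · exact hk b ((Finset.mem_range_succ_iff.mp hb).lt_of_ne hnb) z
      · exact absurd (Finset.mem_range.mpr (lt_add_one k)) hn
    have h1 := hp.isBigO_sub_partialSum_pow (k + 1)
    have h2 : (fun y => h (ζ + y)) =O[𝓝 0] fun y => ‖y‖ ^ (k + 1) := by
      simpa [Function.comp_def] using (hO (k + 1)).comp_tendsto hc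
    have h3 := h2.sub h1
    simp only [psum_eq, sub_sub_cancel] at h3
    exact h3.continuousMultilinearMap_apply_eq_zero
  have hev := hp.eventually_hasSum_sub
  filter_upwards [hev] with z hz
  simp only [hzero] at hz
  exact hz.unique hasSum_zero

lemma taylorTerm_linear_smul_diagonal [CompleteSpace W] {ζ w : Z} {ℓ : Z →L[ℂ] ℂ}
    (hℓ : ℓ w = 1) {k : Z → W} (hk : AnalyticAt ℂ k ζ) (n : ℕ) :
    (taylorTerm ζ ((fun z => ℓ (z - ζ)) • k) n fun _ => w) =
      match n with
      | 0 => 0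
      | n + 1 => taylorTerm ζ k n fun _ => w := by
  have hℓa : AnalyticAt ℂ (fun z => ℓ (z - ζ)) ζ :=
    (ℓ.analyticAt _).comp (analyticAt_id.sub analyticAt_const)
  refine congrFun (coeff_unique (f := fun t : ℂ => t • k (ζ + t • w))
    (a := fun n => taylorTerm ζ ((fun z => ℓ (z - ζ)) • k) n fun _ => w)
    (b := fun n => match n with
      | 0 => 0
      | n + 1 => taylorTerm ζ k n fun _ => w) ?_ ?_) n
  · filter_upwards [eventually_hasSum_taylorTerm_line (hℓa.smul hk) w] with t ht
    simpa [hℓ] using! ht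
  · filter_upwards [eventually_hasSum_taylorTerm_line hk w] with t ht
    rw [← hasSum_nat_add_iff' 1]
    simpa [pow_succ', mul_smul] using ht.const_smul t

namespace IsGermHom

variable {ζ : Z} {A : (Z → V) → Z → W}

lemma const_add (hA : IsGermHom ζ A) (u v : V) :
    A (fun _ => u + v) =ᶠ[𝓝 ζ] A (fun _ => u) + A (fun _ => v) :=
  hA.add analyticAt_const analyticAt_const

lemma const_smul (hA : IsGermHom ζ A) (c : ℂ) (v : V) :
    A (fun _ => c • v) =ᶠ[𝓝 ζ] c • A (fun _ => v) :=
  hA.smul (a := fun _ => c) analyticAt_const analyticAt_const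

variable [CompleteSpace W]

/-- The Taylor terms of the images of the constant germs. -/
noncomputable def taylorMap (hA : IsGermHom ζ A) (n : ℕ) : V →ₗ[ℂ] Z [×n]→L[ℂ] W where
  toFun v := taylorTerm ζ (A fun _ => v) n
  map_add' u v := by
    rw [taylorTerm_congr (hA.const_add u v),
      taylorTerm_add (hA.analyticAt analyticAt_const) (hA.analyticAt analyticAt_const)]
  map_smul' c v := by
    rw [taylorTerm_congr (hA.const_smul c v),
      taylorTerm_const_smul (hA.analyticAt analyticAt_const), RingHom.id_apply]

lemma taylorMap_apply (hA : IsGermHom ζ A) (n : ℕ) (v : V) :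
    hA.taylorMap n v = taylorTerm ζ (A fun _ => v) n := rfl

/-- The image of `∑ eⱼ ℓ ^ j` has Taylor coefficients along a line given by a Cauchy product. -/
lemma taylorTerm_tsum_diagonal [CompleteSpace V] (hA : IsGermHom ζ A) {w : Z} {ℓ : Z →L[ℂ] ℂ}
    (hℓ : ℓ w = 1) (n : ℕ) {e : ℕ → V} (he : ∀ j, ‖e j‖ ≤ 1) :
    (taylorTerm ζ (A fun z => ∑' i, ℓ (z - ζ) ^ i • e i) n fun _ => w) =
      ∑ j ∈ Finset.range (n + 1), hA.taylorMap (n - j) (e j) fun _ => w := by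
  have hℓa : AnalyticAt ℂ (fun z => ℓ (z - ζ)) ζ :=
    (ℓ.analyticAt _).comp (analyticAt_id.sub analyticAt_const)
  have hℓc : Tendsto (fun z => ℓ (z - ζ)) (𝓝 ζ) (𝓝 0) := by
    simpa using hℓa.continuousAt.tendsto
  have han : ∀ {e : ℕ → V}, (∀ j, ‖e j‖ ≤ 1) →
      AnalyticAt ℂ (fun z => ∑' i, ℓ (z - ζ) ^ i • e i) ζ := fun he =>
    AnalyticAt.fun_comp (f := fun z => ℓ (z - ζ))
      (by simpa using (analyticAt_tsum_pow_smul he).1) hℓa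
  induction n generalizing e with
  | zero => ?_
  | succ n ih => ?_
  all_goals
    have hsplit : (fun z => ∑' i, ℓ (z - ζ) ^ i • e i) =ᶠ[𝓝 ζ]
        (fun _ => e 0) + (fun z => ℓ (z - ζ)) • fun z => ∑' i, ℓ (z - ζ) ^ i • e (i + 1) := by
      filter_upwards [hℓc.eventually (analyticAt_tsum_pow_smul he).2,
        hℓc.eventually (analyticAt_tsum_pow_smul fun j => he (j + 1)).2] with z hz hz'
      refine hz.unique ?_
      rw [← hasSum_nat_add_iff' 1]
      simpa [pow_succ', mul_smul] using hz'.const_smul (ℓ (z - ζ))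
    have hs := han fun j => he (j + 1)
    rw [taylorTerm_congr (((hA.congr (han he) hsplit).trans
      (hA.add analyticAt_const (hℓa.smul hs))).trans
        (EventuallyEq.rfl.add (hA.smul hℓa hs))),
      taylorTerm_add (hA.analyticAt analyticAt_const) (hℓa.smul (hA.analyticAt hs)),
      add_apply, taylorTerm_linear_smul_diagonal hℓ (hA.analyticAt hs)]
  · simp [taylorMap_apply]
  · rw [Finset.sum_range_succ']
    simp only [ih fun j => he (j + 1), Nat.sub_zero]
    rw [add_comm, taylorMap_apply hA (n + 1)]
    congr 1
    refine Finset.sum_congr rfl fun j _ => ?_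
    rw [Nat.add_sub_add_right]

lemma continuous_taylorMap_diagonal [CompleteSpace V] [Nontrivial Z] (hA : IsGermHom ζ A) (n : ℕ)
    (w : Z) :
    Continuous fun v => hA.taylorMap n v fun _ => w := by
  have key : ∀ (w : Z), w ≠ 0 → ∀ n, Continuous fun v => hA.taylorMap n v fun _ => w := by
    intro w hw n
    obtain ⟨ℓ, hℓ⟩ := SeparatingDual.exists_eq_one (R := ℂ) hw
    let T : ℕ → V →ₗ[ℂ] W := fun n =>
      { toFun := fun v => hA.taylorMap n v fun _ => w
        map_add' := by simp
        map_smul' := by simp }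
    refine continuous_of_cauchyProduct_bound T (fun e he => ?_) n
    have hℓa : AnalyticAt ℂ (fun z => ℓ (z - ζ)) ζ :=
      (ℓ.analyticAt _).comp (analyticAt_id.sub analyticAt_const)
    have han : AnalyticAt ℂ (fun z => ∑' i, ℓ (z - ζ) ^ i • e i) ζ :=
      AnalyticAt.fun_comp (f := fun z => ℓ (z - ζ))
        (by simpa using (analyticAt_tsum_pow_smul he).1) hℓa
    obtain ⟨N, hN⟩ := exists_norm_taylorTerm_le (hA.analyticAt han)
    obtain ⟨M, hM⟩ := exists_nat_ge (max ‖w‖ 1)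
    refine ⟨N * M, fun n => ?_⟩
    have hM1 : (1 : ℝ) ≤ M := (le_max_right _ _).trans hM
    calc ‖∑ j ∈ Finset.range (n + 1), T (n - j) (e j)‖
        = ‖taylorTerm ζ (A fun z => ∑' i, ℓ (z - ζ) ^ i • e i) n fun _ => w‖ := by
          rw [hA.taylorTerm_tsum_diagonal hℓ n he]; rfl
      _ ≤ (N : ℝ) ^ (n + 1) * ‖w‖ ^ n := by
          refine (ContinuousMultilinearMap.le_opNorm _ _).trans ?_
          simp only [Finset.prod_const, Finset.card_univ, Fintype.card_fin]
          gcongr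
          exact hN n
      _ ≤ (N : ℝ) ^ (n + 1) * (M : ℝ) ^ (n + 1) := by
          gcongr
          calc ‖w‖ ^ n ≤ (M : ℝ) ^ n := by gcongr; exact (le_max_left _ _).trans hM
            _ ≤ (M : ℝ) ^ (n + 1) := pow_le_pow_right₀ hM1 n.le_succ
      _ = ((N * M : ℕ) : ℝ) ^ (n + 1) := by push_cast; rw [mul_pow]
  by_cases hw : w = 0
  · subst hw
    cases n with
    | zero =>
      obtain ⟨w, hw⟩ := exists_ne (0 : Z)
      convert! key w hw 0 using 3
    | succ n =>
      convert! continuous_const (y := (0 : W)) using 2 with v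
      exact (hA.taylorMap (n + 1) v).map_coord_zero 0 rfl
  · exact key w hw n

lemma continuous_taylorMap [CompleteSpace V] [Nontrivial Z] (hA : IsGermHom ζ A) (n : ℕ) :
    Continuous (hA.taylorMap n) := by
  refine (hA.taylorMap n).continuous_of_seq_closed_graph fun u v Q hu hQ => ?_
  have happly : ∀ x : Fin n → Z,
      Tendsto (fun k => hA.taylorMap n (u k) x) atTop (𝓝 (Q x)) := fun x =>
    ((ContinuousMultilinearMap.apply ℂ (fun _ : Fin n => Z) W x).continuous.tendsto Q).comp hQ
  refine eq_taylorTerm_of_diagonal (hA.analyticAt analyticAt_const) (fun x σ => ?_) fun w => ?_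
  · refine tendsto_nhds_unique (happly (x ∘ σ)) ?_
    convert! happly x using 2 with k
    simp only [taylorMap_apply, taylorTerm, smul_apply]
    rw [(hA.analyticAt analyticAt_const).contDiffAt.iteratedFDeriv_comp_perm]
  · exact tendsto_nhds_unique (happly fun _ => w)
      (((hA.continuous_taylorMap_diagonal n w).tendsto v).comp hu)

/-- The images of the constant germs are given by an operator-valued holomorphic germ. -/
lemma exists_analyticAt_const [CompleteSpace V] [Nontrivial Z] (hA : IsGermHom ζ A) :
    ∃ Φ : Z → V →L[ℂ] W, AnalyticAt ℂ Φ ζ ∧ ∀ v, A (fun _ => v) =ᶠ[𝓝 ζ] fun z => Φ z v := by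
  let D : ∀ n, V →L[ℂ] Z [×n]→L[ℂ] W := fun n => ⟨hA.taylorMap n, hA.continuous_taylorMap n⟩
  obtain ⟨C, r, hC, hr, hD⟩ := exists_norm_le_mul_pow_of_pointwise D fun v =>
    exists_norm_taylorTerm_le (hA.analyticAt (analyticAt_const (v := v)))
  let p : FormalMultilinearSeries ℂ Z (V →L[ℂ] W) := fun n => (D n).flipMultilinear
  have hp : ∀ n, ‖p n‖ ≤ C * r ^ n := fun n => by
    refine ContinuousMultilinearMap.opNorm_le_bound (by positivity) fun x => ?_
    refine ContinuousLinearMap.opNorm_le_bound _ (by positivity) fun v => ?_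
    calc ‖D n v x‖ ≤ ‖D n v‖ * ∏ i, ‖x i‖ := (D n v).le_opNorm x
      _ ≤ (C * r ^ n * ‖v‖) * ∏ i, ‖x i‖ := by
        gcongr
        exact (D n).le_of_opNorm_le (hD n) v
      _ = _ := by ring
  have hrad : 0 < p.radius := by
    refine lt_of_lt_of_le ?_
      (p.le_radius_of_bound C (r := ⟨r⁻¹, (inv_pos.2 hr).le⟩) fun n => ?_)
    · exact ENNReal.coe_pos.2 (inv_pos.2 hr)
    · calc ‖p n‖ * r⁻¹ ^ n ≤ C * r ^ n * r⁻¹ ^ n := by gcongr; exact hp n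
        _ = C := by rw [mul_assoc, ← mul_pow, mul_inv_cancel₀ hr.ne', one_pow, mul_one]
  have hΦ : HasFPowerSeriesOnBall (fun z => p.sum (z - ζ)) p ζ p.radius := by
    simpa using (p.hasFPowerSeriesOnBall hrad).comp_sub ζ
  refine ⟨_, hΦ.analyticAt, fun v => ?_⟩
  have hc : Tendsto (fun z => z - ζ) (𝓝 ζ) (𝓝 0) := by
    have hcont : Continuous fun z : Z => z - ζ := by fun_prop
    simpa using hcont.tendsto ζ
  filter_upwards [hΦ.hasFPowerSeriesAt.eventually_hasSum_sub, hc.eventually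
    (eventually_hasSum_taylorTerm (hA.analyticAt (analyticAt_const (v := v))))] with z hz hz'
  rw [add_sub_cancel] at hz'
  exact hz'.unique (hz.mapL (ContinuousLinearMap.apply ℂ W v))

end IsGermHom

/-- A germ homomorphism that kills the constant germs is zero. -/
lemma IsGermHom.eventuallyEq_zero [CompleteSpace V] {m : ℕ} {ζ : Fin m → ℂ}
    {B : ((Fin m → ℂ) → V) → (Fin m → ℂ) → W} (hB : IsGermHom ζ B)
    (hconst : ∀ v, B (fun _ => v) =ᶠ[𝓝 ζ] 0) {f : (Fin m → ℂ) → V} (hf : AnalyticAt ℂ f ζ) :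
    B f =ᶠ[𝓝 ζ] 0 := by
  refine (hB.analyticAt hf).eventuallyEq_zero_of_isBigO fun n => ?_
  induction n generalizing f with
  | zero =>
    simpa using (hB.analyticAt hf).continuousAt.norm.isBoundedUnder_le.isBigO_one ℝ
  | succ n ih =>
    obtain ⟨q, hq, hfq⟩ := hf.exists_eq_add_apply_sub
    have hcoord : ∀ i, AnalyticAt ℂ (fun z : Fin m → ℂ => z i - ζ i) ζ := fun i =>
      ((ContinuousLinearMap.proj (R := ℂ) (φ := fun _ : Fin m => ℂ) i).analyticAt ζ).sub
        analyticAt_const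
    have hqi : ∀ i, AnalyticAt ℂ (fun z => q z (Pi.single i 1)) ζ := fun i =>
      hq.clm_apply analyticAt_const
    have hterm : ∀ i, AnalyticAt ℂ ((fun z : Fin m → ℂ => z i - ζ i) •
        fun z => q z (Pi.single i 1)) ζ := fun i => (hcoord i).smul (hqi i)
    have hsum : ∀ s : Finset (Fin m),
        B (∑ i ∈ s, (fun z : Fin m → ℂ => z i - ζ i) • fun z => q z (Pi.single i 1))
          =O[𝓝 ζ] fun z => ‖z - ζ‖ ^ (n + 1) := by
      intro s
      induction s using Finset.induction_on with
      | empty =>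
        exact (hconst 0).trans_isBigO (Asymptotics.isBigO_zero _ _)
      | insert i s hi ihs =>
        rw [Finset.sum_insert hi]
        refine (hB.add (hterm i) (Finset.analyticAt_sum _ fun j _ => hterm j)).trans_isBigO
          (Asymptotics.IsBigO.add ((hB.smul (hcoord i) (hqi i)).trans_isBigO ?_) ihs)
        simp only [pow_succ']
        refine Asymptotics.IsBigO.smul (k₁ := fun z => z i - ζ i) (k₂ := fun z => ‖z - ζ‖)
          (Asymptotics.IsBigO.of_bound 1 (.of_forall fun z => ?_))
          (ih (hqi i))
        simpa using norm_le_pi_norm (z - ζ) i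
    have hsplit : f =ᶠ[𝓝 ζ] (fun _ => f ζ) +
        ∑ i, (fun z : Fin m → ℂ => z i - ζ i) • fun z => q z (Pi.single i 1) := by
      filter_upwards [hfq] with z hz
      rw [hz]
      simp only [Pi.add_apply, Finset.sum_apply, Pi.smul_apply', add_right_inj]
      conv_lhs => rw [pi_eq_sum_univ' (z - ζ)]
      simp [map_sum]
    refine ((hB.congr hf hsplit).trans (hB.add analyticAt_const
      (Finset.analyticAt_sum _ fun j _ => hterm j))).trans_isBigO ?_
    exact Asymptotics.IsBigO.add ((hconst _).trans_isBigO (Asymptotics.isBigO_zero _ _))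
      (hsum Finset.univ)

/-- Germ homomorphisms in finitely many variables are induced by operator-valued germs. -/
lemma IsGermHom.exists_analyticAt [CompleteSpace V] [CompleteSpace W] {m : ℕ} (hm : 1 ≤ m)
    {ζ : Fin m → ℂ} {A : ((Fin m → ℂ) → V) → (Fin m → ℂ) → W} (hA : IsGermHom ζ A) :
    ∃ Φ : (Fin m → ℂ) → V →L[ℂ] W, AnalyticAt ℂ Φ ζ ∧
      ∀ f, AnalyticAt ℂ f ζ → A f =ᶠ[𝓝 ζ] fun z => Φ z (f z) := by
  have : Nonempty (Fin m) := ⟨⟨0, hm⟩⟩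
  obtain ⟨Φ, hΦ, hconst⟩ := hA.exists_analyticAt_const
  refine ⟨Φ, hΦ, fun f hf => ?_⟩
  have hB : IsGermHom ζ fun f => A f - fun z => Φ z (f z) :=
    { analyticAt := fun hf => (hA.analyticAt hf).sub (hΦ.clm_apply hf)
      congr := fun hf hfg => (hA.congr hf hfg).sub (hfg.mono fun z hz => by simp only [hz])
      add := fun hf hg => by
        filter_upwards [hA.add hf hg] with z hz
        simp only [Pi.sub_apply, hz, Pi.add_apply, map_add]
        abel
      smul := fun ha hf => by
        filter_upwards [hA.smul ha hf] with z hz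
        simp only [Pi.sub_apply, hz, Pi.smul_apply', map_smul, smul_sub] }
  have h0 := hB.eventuallyEq_zero (fun v => ?_) hf
  · filter_upwards [h0] with z hz
    exact sub_eq_zero.1 hz
  · filter_upwards [hconst v] with z hz
    simp [hz]

end GermHom

/-- Every `O_ζ`-homomorphism `O^E_ζ → O^F_ζ` of plain modules at a point
`ζ ∈ ℂ^m`, `1 ≤ m < ∞`, is plain: it is induced by a `Hom(E,F)`-valued holomorphic germ. -/
theorem hom_of_plain_modules_is_plain
    (m : ℕ) (hm : 1 ≤ m) (ζ : Fin m → ℂ)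
    [CompleteSpace E]
    (F : Type*) [NormedAddCommGroup F] [NormedSpace ℂ F] [CompleteSpace F]
    (φ : OEat (Fin m → ℂ) E ζ →ₗ[Oat (Fin m → ℂ) ζ] OEat (Fin m → ℂ) F ζ) :
    ∃ Φ : (Fin m → ℂ) → (E →L[ℂ] F), AnalyticAt ℂ Φ ζ ∧
      ∀ (f : (Fin m → ℂ) → E) (hf : AnalyticAt ℂ f ζ),
        ((φ (germOf (Fin m → ℂ) E ζ f hf) : OEat (Fin m → ℂ) F ζ) :
            Filter.Germ (𝓝 ζ) F) = ↑(fun z => Φ z (f z)) := by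
  choose rep hrep_analytic hrep using fun x : OEat (Fin m → ℂ) F ζ => x.2
  classical
  let A : ((Fin m → ℂ) → E) → (Fin m → ℂ) → F := fun f =>
    if hf : AnalyticAt ℂ f ζ then rep (φ (germOf _ E ζ f hf)) else 0
  have hAf : ∀ f (hf : AnalyticAt ℂ f ζ),
      ((A f : (Fin m → ℂ) → F) : Germ (𝓝 ζ) F) = φ (germOf _ E ζ f hf) := fun f hf => by
    simp only [A, dif_pos hf]
    exact (hrep _).symm
  have hA : IsGermHom ζ A :=
    { analyticAt := fun {f} hf => by
        simp only [A, dif_pos hf]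
        exact hrep_analytic _
      congr := fun {f g} hf hfg => by
        have hg : AnalyticAt ℂ g ζ := hf.congr hfg
        have hgerm : germOf _ E ζ f hf = germOf _ E ζ g hg := Subtype.ext (Germ.coe_eq.2 hfg)
        exact Germ.coe_eq.1 (by rw [hAf f hf, hAf g hg, hgerm])
      add := fun {f g} hf hg => by
        have hgerm : germOf _ E ζ (f + g) (hf.add hg) = germOf _ E ζ f hf + germOf _ E ζ g hg := rfl
        refine Germ.coe_eq.1 ?_
        rw [hAf _ (hf.add hg), hgerm, map_add, Submodule.coe_add, Germ.coe_add, hAf f hf, hAf g hg]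
      smul := fun {a f} ha hf => by
        let c : Oat (Fin m → ℂ) ζ := ⟨(a : Germ (𝓝 ζ) ℂ), a, ha, rfl⟩
        have hgerm : germOf _ E ζ (a • f) (ha.smul hf) = c • germOf _ E ζ f hf := rfl
        refine Germ.coe_eq.1 ?_
        rw [hAf _ (ha.smul hf), hgerm, map_smul, Submodule.coe_smul, ← hAf f hf]
        rfl }
  obtain ⟨Φ, hΦ, h⟩ := hA.exists_analyticAt hm
  exact ⟨Φ, hΦ, fun f hf => (hAf f hf).symm.trans (Germ.coe_eq.2 (h f hf))⟩
end

section
/- Weierstrass division for Banach-valued germs: let h ∈ O_0 be a Weierstrass polynomial of degree d ≥ 1 in z_m at 0 ∈ ℂ^m, and F a complex Banach space. Then every germ f ∈ O^F_0 can be written uniquely as f = h·f_0 + Σ_{j=0}^{d−1} f'_j z_m^j, with f_0 ∈ O^F_0 and f'_j ∈ O'^F_0 germs of F-valued holomorphic functions independent of z_m. Consequently the map f ↦ (f'_0,...,f'_{d−1}) descends to an isomorphism of O'_0-modules O^F_0 / h O^F_0 ≅ (O'^F_0)^{⊕d}. -/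
open Filter Topology

variable (X : Type*) [NormedAddCommGroup X] [NormedSpace ℂ X]

variable (E : Type*) [NormedAddCommGroup E] [NormedSpace ℂ E]

/-- A function on `ℂ^(m+1)` is independent of the last coordinate `z_m`. -/
def IndepLast (m : ℕ) {E : Type*} (f : (Fin (m + 1) → ℂ) → E) : Prop :=
  ∀ z w : Fin (m + 1) → ℂ, (∀ i : Fin m, z i.castSucc = w i.castSucc) → f z = f w

/-- Formal power series spaces: `shift` is multiplication by the variable, `unshift` drops the
constant term and divides by the variable, `incl` and `proj` are the constant series and the
constant coefficient. -/
structure ShiftModel (B F : Type*) [NormedAddCommGroup B] [NormedSpace ℂ B]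
    [NormedAddCommGroup F] [NormedSpace ℂ F] where
  shift : B →L[ℂ] B
  unshift : B →L[ℂ] B
  incl : F →L[ℂ] B
  proj : B →L[ℂ] F
  unshift_shift : ∀ b, unshift (shift b) = b
  unshift_incl : ∀ c, unshift (incl c) = 0
  proj_shift : ∀ b, proj (shift b) = 0
  proj_incl : ∀ c, proj (incl c) = c
  shift_unshift_add : ∀ b, shift (unshift b) + incl (proj b) = b
  eq_zero_of_proj : ∀ b, (∀ k : ℕ, proj ((unshift ^ k) b) = 0) → b = 0

namespace ShiftModel

variable {B F : Type*} [NormedAddCommGroup B] [NormedSpace ℂ B]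
    [NormedAddCommGroup F] [NormedSpace ℂ F] (M : ShiftModel B F)

theorem unshift_pow_shift_pow (k : ℕ) (b : B) : (M.unshift ^ k) ((M.shift ^ k) b) = b := by
  induction k generalizing b with
  | zero => simp
  | succ k ih => rw [pow_succ, pow_succ', mul_apply_eq_comp, mul_apply_eq_comp, M.unshift_shift, ih]

theorem unshift_pow_shift_pow_incl {j k : ℕ} (h : j < k) (c : F) :
    (M.unshift ^ k) ((M.shift ^ j) (M.incl c)) = 0 := by
  obtain ⟨i, rfl⟩ := Nat.exists_eq_add_of_lt h
  rw [show j + i + 1 = i + 1 + j by omega, pow_add, mul_apply_eq_comp, unshift_pow_shift_pow,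
    pow_succ, mul_apply_eq_comp, M.unshift_incl, map_zero]

theorem proj_unshift_pow_shift_pow {j k : ℕ} (h : j < k) (b : B) :
    M.proj ((M.unshift ^ j) ((M.shift ^ k) b)) = 0 := by
  obtain ⟨i, rfl⟩ := Nat.exists_eq_add_of_lt h
  rw [add_assoc, pow_add, mul_apply_eq_comp, unshift_pow_shift_pow, pow_succ', mul_apply_eq_comp,
    M.proj_shift]

theorem shift_pow_unshift_pow_add_sum (d : ℕ) (b : B) :
    (M.shift ^ d) ((M.unshift ^ d) b)
      + ∑ j : Fin d, (M.shift ^ (j : ℕ)) (M.incl (M.proj ((M.unshift ^ (j : ℕ)) b))) = b := by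
  induction d with
  | zero => simp
  | succ d ih =>
    rw [Fin.sum_univ_castSucc]
    conv_rhs => rw [← ih, ← M.shift_unshift_add ((M.unshift ^ d) b), map_add]
    rw [pow_succ, pow_succ']
    simp only [mul_apply_eq_comp, Fin.val_castSucc, Fin.val_last]
    abel

theorem unshift_pow_remainder (d : ℕ) (q : B) (r : Fin d → F) :
    (M.unshift ^ d) ((M.shift ^ d) q + ∑ j : Fin d, (M.shift ^ (j : ℕ)) (M.incl (r j))) = q := by
  rw [map_add, map_sum, unshift_pow_shift_pow, Finset.sum_eq_zero, add_zero]
  intro j _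
  exact M.unshift_pow_shift_pow_incl j.2 _

theorem proj_unshift_pow_remainder (d : ℕ) (q : B) (r : Fin d → F) (i : Fin d) :
    M.proj ((M.unshift ^ (i : ℕ))
      ((M.shift ^ d) q + ∑ j : Fin d, (M.shift ^ (j : ℕ)) (M.incl (r j)))) = r i := by
  rw [map_add, map_sum, map_add, map_sum, Finset.sum_eq_single i]
  · rw [M.proj_unshift_pow_shift_pow i.2, unshift_pow_shift_pow, M.proj_incl, zero_add]
  · intro j _ hj
    rcases lt_or_gt_of_ne (Fin.val_ne_of_ne hj) with h | h
    · rw [M.unshift_pow_shift_pow_incl h, map_zero]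
    · exact M.proj_unshift_pow_shift_pow h _
  · simp

/-- Evaluation of a series at `w`, as the constant coefficient of the resolvent of `unshift`. -/
noncomputable def ev (w : ℂ) : B →L[ℂ] F := M.proj ∘L Ring.inverse (1 - w • M.unshift)

theorem ev_shift {w : ℂ} (hw : IsUnit (1 - w • M.unshift)) (b : B) :
    M.ev w (M.shift b) = w • M.ev w b := by
  have h (x : B) : Ring.inverse (1 - w • M.unshift) ((1 - w • M.unshift) x) = x := by
    rw [← mul_apply_eq_comp, Ring.inverse_mul_cancel _ hw]; rfl
  have h' (x : B) : (1 - w • M.unshift) (Ring.inverse (1 - w • M.unshift) x) = x := by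
    rw [← mul_apply_eq_comp, Ring.mul_inverse_cancel _ hw]; rfl
  have key : Ring.inverse (1 - w • M.unshift) (M.shift b)
      = M.shift b + w • Ring.inverse (1 - w • M.unshift) b := by
    rw [← h (M.shift b + w • Ring.inverse (1 - w • M.unshift) b), map_add, map_smul, h']
    simp [M.unshift_shift]
  simp [ev, key, M.proj_shift]

theorem ev_shift_pow {w : ℂ} (hw : IsUnit (1 - w • M.unshift)) (k : ℕ) (b : B) :
    M.ev w ((M.shift ^ k) b) = w ^ k • M.ev w b := by
  induction k with
  | zero => simp
  | succ k ih =>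
    rw [pow_succ', mul_apply_eq_comp, M.ev_shift hw, ih, pow_succ', mul_smul]

theorem ev_incl {w : ℂ} (hw : IsUnit (1 - w • M.unshift)) (c : F) : M.ev w (M.incl c) = c := by
  have h : Ring.inverse (1 - w • M.unshift) ((1 - w • M.unshift) (M.incl c)) = M.incl c := by
    rw [← mul_apply_eq_comp, Ring.inverse_mul_cancel _ hw]; rfl
  have h' : (1 - w • M.unshift) (M.incl c) = M.incl c := by simp [M.unshift_incl]
  rw [h'] at h
  simp [ev, h, M.proj_incl]

theorem ev_zero (b : B) : M.ev 0 b = M.proj b := by simp [ev]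

variable [CompleteSpace B]

theorem eventually_isUnit : ∀ᶠ w : ℂ in 𝓝 0, IsUnit (1 - w • M.unshift) := by
  have hc : ContinuousAt (fun w : ℂ => 1 - w • M.unshift) 0 := by fun_prop
  exact hc.eventually (Units.isOpen.eventually_mem (by simp))

theorem analyticAt_ev : AnalyticAt ℂ M.ev 0 := by
  have h1 : AnalyticAt ℂ (fun w : ℂ => 1 - w • M.unshift) 0 := by fun_prop
  have h2 : AnalyticAt ℂ (Ring.inverse : (B →L[ℂ] B) → _) (1 - (0 : ℂ) • M.unshift) := by
    have := analyticAt_inverse (𝕜 := ℂ) (1 : (B →L[ℂ] B)ˣ)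
    simpa using this
  exact ((ContinuousLinearMap.compL ℂ B B F M.proj).analyticAt _).comp
    (h2.comp (f := fun w : ℂ => 1 - w • M.unshift) h1)

theorem eventually_ev_unshift {b : B} (hb : ∀ᶠ w in 𝓝 0, M.ev w b = 0) :
    ∀ᶠ w in 𝓝 0, M.ev w (M.unshift b) = 0 := by
  have hp : M.proj b = 0 := by simpa [ev_zero] using hb.self_of_nhds
  have hne : ∀ᶠ w in 𝓝[≠] (0 : ℂ), M.ev w (M.unshift b) = 0 := by
    filter_upwards [hb.filter_mono nhdsWithin_le_nhds,
      M.eventually_isUnit.filter_mono nhdsWithin_le_nhds, self_mem_nhdsWithin] with w h1 h2 h3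
    rw [← M.shift_unshift_add b, hp, map_zero, add_zero, M.ev_shift h2] at h1
    exact (smul_eq_zero.1 h1).resolve_left h3
  have hc : AnalyticAt ℂ (fun w => M.ev w (M.unshift b)) 0 := 
    ((ContinuousLinearMap.apply ℂ F (M.unshift b)).analyticAt _).comp M.analyticAt_ev
  exact hc.frequently_zero_iff_eventually_zero.1 hne.frequently

theorem eq_zero_of_eventually_ev {b : B} (hb : ∀ᶠ w in 𝓝 0, M.ev w b = 0) : b = 0 := by
  have h (k : ℕ) : ∀ᶠ w in 𝓝 0, M.ev w ((M.unshift ^ k) b) = 0 := by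
    induction k with
    | zero => simpa using hb
    | succ k ih => rw [pow_succ']; exact M.eventually_ev_unshift ih
  exact M.eq_zero_of_proj b fun k => by simpa [ev_zero] using (h k).self_of_nhds

end ShiftModel

/-- Rescaling the variable of a shift model by `ρ`. -/
noncomputable def ShiftModel.rescale {B F : Type*} [NormedAddCommGroup B] [NormedSpace ℂ B]
    [NormedAddCommGroup F] [NormedSpace ℂ F] (M : ShiftModel B F) {ρ : ℂ} (hρ : ρ ≠ 0) :
    ShiftModel B F where
  shift := ρ • M.shift
  unshift := ρ⁻¹ • M.unshift
  incl := M.incl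
  proj := M.proj
  unshift_shift b := by simp [M.unshift_shift, smul_smul, hρ]
  unshift_incl c := by simp [M.unshift_incl]
  proj_shift b := by simp [M.proj_shift]
  proj_incl := M.proj_incl
  shift_unshift_add b := by simp [smul_smul, hρ, M.shift_unshift_add]
  eq_zero_of_proj b hb := M.eq_zero_of_proj b fun k => by
    have h := hb k
    rw [smul_pow, smul_apply, map_smul] at h
    exact (smul_eq_zero.1 h).resolve_left (pow_ne_zero _ (inv_ne_zero hρ))

section BoundedSequences

open BoundedContinuousFunction

variable (F : Type*) [NormedAddCommGroup F] [NormedSpace ℂ F]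

/-- The right shift on bounded sequences. -/
noncomputable def boundedShift : (ℕ →ᵇ F) →L[ℂ] (ℕ →ᵇ F) :=
  LinearMap.mkContinuous
    { toFun b := ofNormedAddCommGroupDiscrete (fun k => Nat.casesOn k 0 fun k => b k) ‖b‖ (by
        rintro (_ | k)
        · simp
        · exact b.norm_coe_le_norm k)
      map_add' b c := by ext (_ | k) <;> simp
      map_smul' r b := by ext (_ | k) <;> simp } 1 (fun b => by
    rw [one_mul]
    refine (BoundedContinuousFunction.norm_le (norm_nonneg _)).2 ?_
    rintro (_ | k)
    · simp
    · exact b.norm_coe_le_norm k)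

/-- The left shift on bounded sequences. -/
noncomputable def boundedUnshift : (ℕ →ᵇ F) →L[ℂ] (ℕ →ᵇ F) :=
  LinearMap.mkContinuous
    { toFun b := b.compContinuous ⟨Nat.succ, continuous_of_discreteTopology⟩
      map_add' b c := by ext k; simp
      map_smul' r b := by ext k; simp } 1 (fun b => by
    rw [one_mul]
    exact (BoundedContinuousFunction.norm_le (norm_nonneg _)).2 fun k => b.norm_coe_le_norm _)

/-- The inclusion of the constant coefficient into bounded sequences. -/
noncomputable def boundedIncl : F →L[ℂ] (ℕ →ᵇ F) :=
  LinearMap.mkContinuous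
    { toFun c := ofNormedAddCommGroupDiscrete (fun k => Nat.casesOn k c fun _ => 0) ‖c‖ (by
        rintro (_ | k) <;> simp)
      map_add' b c := by ext (_ | k) <;> simp
      map_smul' r b := by ext (_ | k) <;> simp } 1 (fun b => by
    rw [one_mul]
    refine (BoundedContinuousFunction.norm_le (norm_nonneg _)).2 ?_
    rintro (_ | k) <;> simp)

theorem boundedUnshift_pow_apply (n : ℕ) (b : ℕ →ᵇ F) (k : ℕ) :
    (boundedUnshift F ^ n) b k = b (k + n) := by
  induction n generalizing k with
  | zero => rfl
  | succ n ih =>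
    rw [pow_succ', mul_apply_eq_comp]
    exact (ih (k + 1)).trans (by rw [add_right_comm, add_assoc])

/-- Power series with bounded coefficients. -/
noncomputable def boundedShiftModel : ShiftModel (ℕ →ᵇ F) F where
  shift := boundedShift F
  unshift := boundedUnshift F
  incl := boundedIncl F
  proj := evalCLM ℂ 0
  unshift_shift b := by ext k; rfl
  unshift_incl c := by ext k; rfl
  proj_shift b := rfl
  proj_incl c := rfl
  shift_unshift_add b := by
    ext (_ | k)
    · exact zero_add _
    · exact add_zero _
  eq_zero_of_proj b hb := by
    ext k
    have h := hb k
    rwa [evalCLM_apply, boundedUnshift_pow_apply, zero_add] at h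

end BoundedSequences

section Substitution

variable {B F : Type*} [NormedAddCommGroup B] [NormedSpace ℂ B]
  [NormedAddCommGroup F] [NormedSpace ℂ F] {n : ℕ}

/-- The power series obtained by substituting operators on `B` for the variables of a power
series in `n` variables, with coefficients mapped to `B` by `ι`. -/
noncomputable def substSeries (p : FormalMultilinearSeries ℂ (Fin n → ℂ) F) (ι : F →L[ℂ] B) :
    FormalMultilinearSeries ℂ (Fin n → (B →L[ℂ] B)) B := fun k =>
  ∑ i : Fin k → Fin n,
    (ContinuousLinearMap.apply ℂ B
        (ι (p k fun l => Pi.single (i l) 1))).compContinuousMultilinearMap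
      ((ContinuousMultilinearMap.mkPiAlgebraFin ℂ k (B →L[ℂ] B)).compContinuousLinearMap
        fun l => ContinuousLinearMap.proj (i l))

theorem substSeries_apply (p : FormalMultilinearSeries ℂ (Fin n → ℂ) F) (ι : F →L[ℂ] B) (k : ℕ)
    (x : Fin k → Fin n → (B →L[ℂ] B)) :
    substSeries p ι k x = ∑ i : Fin k → Fin n,
      (List.ofFn fun l => x l (i l)).prod (ι (p k fun l => Pi.single (i l) 1)) := by
  simp [substSeries]

theorem norm_list_ofFn_prod_apply_le {k : ℕ} (x : Fin k → (B →L[ℂ] B)) (b : B) :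
    ‖(List.ofFn x).prod b‖ ≤ (∏ l, ‖x l‖) * ‖b‖ := by
  induction k with
  | zero => simp
  | succ k ih =>
    rw [List.ofFn_succ, List.prod_cons, mul_apply_eq_comp, Fin.prod_univ_succ, mul_assoc]
    exact ((x 0).le_opNorm _).trans (by gcongr; exact ih _)

theorem norm_substSeries_le (p : FormalMultilinearSeries ℂ (Fin n → ℂ) F) (ι : F →L[ℂ] B)
    (k : ℕ) : ‖substSeries p ι k‖ ≤ n ^ k * (‖ι‖ * ‖p k‖) := by
  refine ContinuousMultilinearMap.opNorm_le_bound (by positivity) fun x => ?_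
  have h (i : Fin k → Fin n) :
      ‖(List.ofFn fun l => x l (i l)).prod (ι (p k fun l => Pi.single (i l) 1))‖
        ≤ (∏ l, ‖x l‖) * (‖ι‖ * ‖p k‖) := by
    refine (norm_list_ofFn_prod_apply_le _ _).trans ?_
    gcongr with l
    · exact norm_le_pi_norm _ _
    · refine (ι.le_opNorm _).trans ?_
      gcongr
      exact ((p k).le_opNorm _).trans (by simp [Pi.norm_single])
  rw [substSeries_apply]
  refine (norm_sum_le_of_le _ fun i _ => h i).trans (le_of_eq ?_)
  simp
  ring

theorem substSeries_radius_pos {p : FormalMultilinearSeries ℂ (Fin n → ℂ) F} (hp : 0 < p.radius)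
    (ι : F →L[ℂ] B) : 0 < (substSeries p ι).radius := by
  obtain ⟨C, r, hC, hr, h⟩ := p.le_mul_pow_of_radius_pos hp
  have hs : 0 < ((n + 1 : ℝ) * r)⁻¹ := by positivity
  let s : NNReal := ⟨((n + 1 : ℝ) * r)⁻¹, hs.le⟩
  have hs' : (0 : ENNReal) < s := by exact_mod_cast (show (0 : NNReal) < s from hs)
  refine hs'.trans_le ((substSeries p ι).le_radius_of_bound (‖ι‖ * C) fun k => ?_)
  calc ‖substSeries p ι k‖ * (s : ℝ) ^ k
      ≤ ((n + 1 : ℝ) ^ k * (‖ι‖ * (C * r ^ k))) * (s : ℝ) ^ k := by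
        gcongr
        refine (norm_substSeries_le p ι k).trans ?_
        gcongr
        · linarith
        · exact h k
    _ = ‖ι‖ * C * (((n + 1 : ℝ) * r) * s) ^ k := by rw [mul_pow, mul_pow]; ring
    _ = ‖ι‖ * C := by
        have : ((n + 1 : ℝ) * r) * s = 1 := mul_inv_cancel₀ (by positivity)
        rw [this, one_pow, mul_one]

/-- Operators acting as scalars under a map `e` turn the substituted series into the original. -/
theorem map_substSeries_apply (p : FormalMultilinearSeries ℂ (Fin n → ℂ) F) (ι : F →L[ℂ] B)
    (e : B →L[ℂ] F) (he : ∀ c, e (ι c) = c) (z : Fin n → ℂ) (x : Fin n → (B →L[ℂ] B))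
    (hx : ∀ i b, e (x i b) = z i • e b) (k : ℕ) :
    e (substSeries p ι k fun _ => x) = p k fun _ => z := by
  have hprod (k : ℕ) (i : Fin k → Fin n) (b : B) :
      e ((List.ofFn fun l => x (i l)).prod b) = (∏ l, z (i l)) • e b := by
    induction k with
    | zero => simp
    | succ k ih =>
      rw [List.ofFn_succ, List.prod_cons, mul_apply_eq_comp, Fin.prod_univ_succ, hx, mul_smul]
      exact congrArg _ (ih fun l => i l.succ)
  have hz : z = ∑ j, z j • (Pi.single j 1 : Fin n → ℂ) := by
    ext j; simp [Finset.sum_apply, Pi.single_apply]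
  rw [substSeries_apply, map_sum]
  conv_rhs => rw [hz]
  rw [ContinuousMultilinearMap.map_sum]
  refine Finset.sum_congr rfl fun i _ => ?_
  rw [hprod, he, ContinuousMultilinearMap.map_smul_univ]

end Substitution

section Division

variable {B F : Type*} [NormedAddCommGroup B] [NormedSpace ℂ B]
  [NormedAddCommGroup F] [NormedSpace ℂ F] {m : ℕ}

/-- The operator sending `z_m ^ d q + r`, with `r` of degree below `d` in `z_m`, to
`(z_m ^ d + ∑ a_j z_m ^ j) q + r`. -/
noncomputable def ShiftModel.divisor (M : ShiftModel B F) {d : ℕ}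
    (a : Fin d → ((Fin (m + 1) → ℂ) → ℂ)) (z : Fin (m + 1) → ℂ) : B →L[ℂ] B :=
  1 + ∑ j : Fin d, a j z • (M.shift ^ (j : ℕ) * M.unshift ^ d)

theorem ShiftModel.divisor_remainder (M : ShiftModel B F) {d : ℕ}
    (a : Fin d → ((Fin (m + 1) → ℂ) → ℂ)) (z : Fin (m + 1) → ℂ) (q : B) (r : Fin d → F) :
    M.divisor a z ((M.shift ^ d) q + ∑ j : Fin d, (M.shift ^ (j : ℕ)) (M.incl (r j)))
      = (M.shift ^ d) q + ∑ j : Fin d, (M.shift ^ (j : ℕ)) (M.incl (r j))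
        + ∑ j : Fin d, a j z • (M.shift ^ (j : ℕ)) q := by
  simp only [divisor, add_apply, one_apply_eq_self, sum_apply, smul_apply, mul_apply_eq_comp,
    M.unshift_pow_remainder]

theorem ShiftModel.divisor_indepLast (M : ShiftModel B F) {d : ℕ}
    {a : Fin d → ((Fin (m + 1) → ℂ) → ℂ)} (ha : ∀ j, IndepLast m (a j)) :
    IndepLast m (M.divisor a) := fun z w hzw => by
  simp only [divisor, fun j => ha j z w hzw]

theorem ShiftModel.divisor_zero (M : ShiftModel B F) {d : ℕ}
    {a : Fin d → ((Fin (m + 1) → ℂ) → ℂ)} (ha : ∀ j, a j 0 = 0) : M.divisor a 0 = 1 := by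
  simp [divisor, ha]

theorem ShiftModel.analyticAt_divisor (M : ShiftModel B F) {d : ℕ}
    {a : Fin d → ((Fin (m + 1) → ℂ) → ℂ)} (ha : ∀ j, AnalyticAt ℂ (a j) 0) :
    AnalyticAt ℂ (M.divisor a) 0 :=
  analyticAt_const.add
    (Finset.analyticAt_fun_sum _ fun j _ => (ha j).smul analyticAt_const)

variable [CompleteSpace B]

/-- A germ is the evaluation, in the last variable, of a germ with values in a rescaled shift
model and independent of the last variable. -/
theorem ShiftModel.exists_lift (M : ShiftModel B F) {f : (Fin (m + 1) → ℂ) → F}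
    (hf : AnalyticAt ℂ f 0) :
    ∃ (ρ : ℂ) (hρ : ρ ≠ 0) (g : (Fin (m + 1) → ℂ) → B), AnalyticAt ℂ g 0 ∧ IndepLast m g ∧
      ∀ᶠ z in 𝓝 0, (M.rescale hρ).ev (z (Fin.last m)) (g z) = f z := by
  obtain ⟨p, hp⟩ := hf
  have hG := (substSeries p M.incl).hasFPowerSeriesOnBall
    (substSeries_radius_pos hp.radius_pos M.incl)
  set R := (substSeries p M.incl).radius
  let x (ρ : ℂ) (z : Fin (m + 1) → ℂ) : Fin (m + 1) → (B →L[ℂ] B) :=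
    fun i => if i = Fin.last m then ρ • M.shift else z i • 1
  have hx_mem : ∀ᶠ ρ in 𝓝 (0 : ℂ), x ρ 0 ∈ Metric.eball 0 R := by
    have hc : Continuous fun ρ => x ρ 0 := by
      refine continuous_pi fun i => ?_
      by_cases hi : i = Fin.last m <;> simp only [x, hi, if_true, if_false] <;> fun_prop
    refine hc.continuousAt.eventually (Metric.isOpen_eball.eventually_mem ?_)
    have : x 0 0 = 0 := by ext i; simp [x]
    simp only [this]
    exact Metric.mem_eball_self hG.r_pos
  obtain ⟨ρ, hρR, hρ⟩ :=
    ((hx_mem.filter_mono nhdsWithin_le_nhds).and (self_mem_nhdsWithin (s := {(0 : ℂ)}ᶜ))).exists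
  have hxa : AnalyticAt ℂ (x ρ) 0 := by
    refine AnalyticAt.pi fun i => ?_
    by_cases hi : i = Fin.last m
    · simp only [hi, if_true]; exact analyticAt_const
    · simp only [hi, if_false]
      exact ((ContinuousLinearMap.proj (R := ℂ) (φ := fun _ : Fin (m + 1) => ℂ) i).analyticAt
        _).smul analyticAt_const
  refine ⟨ρ, hρ, fun z => (substSeries p M.incl).sum (x ρ z), ?_, ?_, ?_⟩
  · exact (hG.analyticAt_of_mem hρR).comp hxa
  · intro z w hzw
    have : x ρ z = x ρ w := by
      ext1 i
      refine Fin.lastCases ?_ (fun i => ?_) i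
      · simp [x]
      · simp [x, hzw]
    exact congrArg _ this
  · have hlast : Tendsto (fun z : Fin (m + 1) → ℂ => z (Fin.last m)) (𝓝 0) (𝓝 0) :=
      (continuous_apply _).tendsto' _ _ rfl
    filter_upwards [hp.eventually_hasSum, hlast.eventually (M.rescale hρ).eventually_isUnit,
      hxa.continuousAt.eventually (Metric.isOpen_eball.eventually_mem hρR)] with z hz hu hxz
    have hs := (hG.hasSum hxz).mapL ((M.rescale hρ).ev (z (Fin.last m)))
    rw [zero_add] at hs hz
    have hk := map_substSeries_apply p M.incl _ ((M.rescale hρ).ev_incl hu) z (x ρ z) (by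
      intro i b
      by_cases hi : i = Fin.last m
      · subst hi
        simp only [x, if_true]
        exact (M.rescale hρ).ev_shift hu b
      · simp [x, hi])
    simp only [hk] at hs
    exact hs.unique hz

theorem ShiftModel.eventually_isUnit_divisor (M : ShiftModel B F) {d : ℕ}
    {a : Fin d → ((Fin (m + 1) → ℂ) → ℂ)}
    (ha : ∀ j, AnalyticAt ℂ (a j) 0 ∧ IndepLast m (a j) ∧ a j 0 = 0) :
    ∀ᶠ z in 𝓝 0, IsUnit (M.divisor a z) :=
  (M.analyticAt_divisor fun j => (ha j).1).continuousAt.eventually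
    (Units.isOpen.eventually_mem (by simp [M.divisor_zero fun j => (ha j).2.2]))

theorem ShiftModel.analyticAt_inverse_divisor (M : ShiftModel B F) {d : ℕ}
    {a : Fin d → ((Fin (m + 1) → ℂ) → ℂ)}
    (ha : ∀ j, AnalyticAt ℂ (a j) 0 ∧ IndepLast m (a j) ∧ a j 0 = 0) :
    AnalyticAt ℂ (fun z => Ring.inverse (M.divisor a z)) 0 :=
  (analyticAt_inverse (𝕜 := ℂ) (1 : (B →L[ℂ] B)ˣ)).comp_of_eq
    (M.analyticAt_divisor fun j => (ha j).1)
    (by simp [M.divisor_zero fun j => (ha j).2.2])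

/-- Uniqueness of division by a Weierstrass polynomial. -/
theorem ShiftModel.division_unique (M : ShiftModel B F) {d : ℕ}
    {a : Fin d → ((Fin (m + 1) → ℂ) → ℂ)}
    (ha : ∀ j, AnalyticAt ℂ (a j) 0 ∧ IndepLast m (a j) ∧ a j 0 = 0)
    {q : (Fin (m + 1) → ℂ) → F} {r : Fin d → ((Fin (m + 1) → ℂ) → F)}
    (hq : AnalyticAt ℂ q 0) (hr : ∀ j, IndepLast m (r j))
    (h : ∀ᶠ z in 𝓝 0,
      (z (Fin.last m) ^ d + ∑ j : Fin d, a j z * z (Fin.last m) ^ (j : ℕ)) • q z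
        + ∑ j : Fin d, z (Fin.last m) ^ (j : ℕ) • r j z = 0) :
    ∀ᶠ z in 𝓝 0, q z = 0 ∧ ∀ j, r j z = 0 := by
  obtain ⟨ρ, hρ, g, -, hgi, hgq⟩ := M.exists_lift hq
  generalize M.rescale hρ = N at hgq
  let W (z : Fin (m + 1) → ℂ) : B := N.divisor a z
      ((N.shift ^ d) (g z) + ∑ j : Fin d, (N.shift ^ (j : ℕ)) (N.incl (r j z)))
  have hWi : IndepLast m W := fun z w hzw => by
    simp only [W, N.divisor_indepLast (fun j => (ha j).2.1) z w hzw, hgi z w hzw,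
      fun j => hr j z w hzw]
  have hlast : Tendsto (fun z : Fin (m + 1) → ℂ => z (Fin.last m)) (𝓝 0) (𝓝 0) :=
    (continuous_apply _).tendsto' _ _ rfl
  have hW : ∀ᶠ z in 𝓝 0, N.ev (z (Fin.last m)) (W z) = 0 := by
    filter_upwards [h, hgq, hlast.eventually N.eventually_isUnit] with z h1 h2 h3
    rw [← h1, ← h2]
    simp only [W, N.divisor_remainder, map_add, map_sum, map_smul, N.ev_shift_pow h3, N.ev_incl h3,
      add_smul, Finset.sum_smul, mul_smul]
    abel
  have hcurry : ∀ᶠ z in 𝓝 (0 : Fin (m + 1) → ℂ), ∀ᶠ w in 𝓝 (0 : ℂ), N.ev w (W z) = 0 := by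
    have ht : Tendsto (fun y : (Fin (m + 1) → ℂ) × ℂ => Function.update y.1 (Fin.last m) y.2)
        (𝓝 0 ×ˢ 𝓝 0) (𝓝 0) := by
      rw [← nhds_prod_eq]
      exact (continuous_fst.update _ continuous_snd).tendsto' _ _ (by simp)
    filter_upwards [(ht.eventually hW).curry] with z hz
    filter_upwards [hz] with w hw
    rw [Function.update_self] at hw
    rwa [hWi z (Function.update z (Fin.last m) w) fun i => by
      rw [Function.update_of_ne (Fin.castSucc_lt_last i).ne]]
  filter_upwards [hcurry, hgq, N.eventually_isUnit_divisor ha] with z h1 h2 h3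
  have h0 : (N.shift ^ d) (g z) + ∑ j : Fin d, (N.shift ^ (j : ℕ)) (N.incl (r j z)) = 0 := by
    have hinv := congrArg (fun b => Ring.inverse (N.divisor a z) b)
      (N.eq_zero_of_eventually_ev h1)
    simp only [W] at hinv
    rwa [← mul_apply_eq_comp, Ring.inverse_mul_cancel _ h3, one_apply_eq_self, map_zero] at hinv
  constructor
  · rw [← h2, ← N.unshift_pow_remainder d (g z) fun j => r j z, h0, map_zero, map_zero]
  · intro j
    rw [← N.proj_unshift_pow_remainder d (g z) (fun j => r j z) j, h0, map_zero, map_zero]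

/-- Existence of division by a Weierstrass polynomial. -/
theorem ShiftModel.exists_division (M : ShiftModel B F) {d : ℕ}
    {a : Fin d → ((Fin (m + 1) → ℂ) → ℂ)}
    (ha : ∀ j, AnalyticAt ℂ (a j) 0 ∧ IndepLast m (a j) ∧ a j 0 = 0)
    {f : (Fin (m + 1) → ℂ) → F} (hf : AnalyticAt ℂ f 0) :
    ∃ (q : (Fin (m + 1) → ℂ) → F) (r : Fin d → ((Fin (m + 1) → ℂ) → F)),
      AnalyticAt ℂ q 0 ∧ (∀ j, AnalyticAt ℂ (r j) 0 ∧ IndepLast m (r j)) ∧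
      ∀ᶠ z in 𝓝 0, f z =
        (z (Fin.last m) ^ d + ∑ j : Fin d, a j z * z (Fin.last m) ^ (j : ℕ)) • q z
          + ∑ j : Fin d, z (Fin.last m) ^ (j : ℕ) • r j z := by
  obtain ⟨ρ, hρ, g, hga, hgi, hgf⟩ := M.exists_lift hf
  generalize M.rescale hρ = N at hgf
  let v (z : Fin (m + 1) → ℂ) : B := Ring.inverse (N.divisor a z) (g z)
  have hva : AnalyticAt ℂ v 0 :=
    ((ContinuousLinearMap.id ℂ (B →L[ℂ] B)).analyticAt_bilinear _).comp₂
      (N.analyticAt_inverse_divisor ha) hga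
  have hvi : IndepLast m v := fun z w hzw => by
    simp only [v, N.divisor_indepLast (fun j => (ha j).2.1) z w hzw, hgi z w hzw]
  have hlast : Tendsto (fun z : Fin (m + 1) → ℂ => z (Fin.last m)) (𝓝 0) (𝓝 0) :=
    (continuous_apply _).tendsto' _ _ rfl
  refine ⟨fun z => N.ev (z (Fin.last m)) ((N.unshift ^ d) (v z)),
    fun j z => N.proj ((N.unshift ^ (j : ℕ)) (v z)), ?_, fun j => ⟨?_, ?_⟩, ?_⟩
  · have he : AnalyticAt ℂ (fun z : Fin (m + 1) → ℂ => N.ev (z (Fin.last m))) 0 :=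
      N.analyticAt_ev.comp_of_eq ((ContinuousLinearMap.proj (R := ℂ)
        (φ := fun _ : Fin (m + 1) => ℂ) (Fin.last m)).analyticAt 0) rfl
    exact ((ContinuousLinearMap.id ℂ (B →L[ℂ] F)).analyticAt_bilinear _).comp₂ he
      (((N.unshift ^ d).analyticAt _).comp hva)
  · exact ((N.proj ∘L N.unshift ^ (j : ℕ)).analyticAt _).comp hva
  · intro z w hzw
    simp only [hvi z w hzw]
  · filter_upwards [hgf, hlast.eventually N.eventually_isUnit,
      N.eventually_isUnit_divisor ha] with z h1 h2 h3
    have hg : N.divisor a z (v z) = g z := by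
      simp only [v]
      rw [← mul_apply_eq_comp, Ring.mul_inverse_cancel _ h3, one_apply_eq_self]
    have hdiv := N.divisor_remainder a z ((N.unshift ^ d) (v z))
      fun j => N.proj ((N.unshift ^ (j : ℕ)) (v z))
    nth_rewrite 1 [N.shift_pow_unshift_pow_add_sum] at hdiv
    rw [hg] at hdiv
    rw [← h1, hdiv]
    simp only [map_add, map_sum, map_smul, N.ev_shift_pow h2, N.ev_incl h2,
      add_smul, Finset.sum_smul, mul_smul]
    abel

end Division

/-- Weierstrass division for Banach-valued germs: if
`h = z_m^d + ∑_{j<d} a_j z_m^j` is a Weierstrass polynomial of degree `d ≥ 1` at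
`0 ∈ ℂ^(m+1)`, every germ `f ∈ O^F_0` can be written uniquely as
`f = h f₀ + ∑_{j<d} f'_j z_m^j` with `f₀ ∈ O^F_0` and `f'_j ∈ O'^F_0` independent of the
last variable. -/
theorem weierstrass_division_banach
    (m : ℕ) (F : Type*) [NormedAddCommGroup F] [NormedSpace ℂ F] [CompleteSpace F]
    (d : ℕ) (hd : 1 ≤ d) (a : Fin d → ((Fin (m + 1) → ℂ) → ℂ))
    (ha : ∀ j, AnalyticAt ℂ (a j) 0 ∧ IndepLast m (a j) ∧ a j 0 = 0)
    (f : ↥(OEat (Fin (m + 1) → ℂ) F 0)) :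
    ∃ (f₀ : (Fin (m + 1) → ℂ) → F) (f' : Fin d → ((Fin (m + 1) → ℂ) → F)),
      AnalyticAt ℂ f₀ 0 ∧ (∀ j, AnalyticAt ℂ (f' j) 0 ∧ IndepLast m (f' j)) ∧
      ((f : Filter.Germ (𝓝 (0 : Fin (m + 1) → ℂ)) F) =
        ↑(fun z => (z (Fin.last m) ^ d + ∑ j : Fin d, a j z * z (Fin.last m) ^ (j : ℕ)) • f₀ z
            + ∑ j : Fin d, z (Fin.last m) ^ (j : ℕ) • f' j z)) ∧
      ∀ (g₀ : (Fin (m + 1) → ℂ) → F) (g' : Fin d → ((Fin (m + 1) → ℂ) → F)),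
        AnalyticAt ℂ g₀ 0 → (∀ j, AnalyticAt ℂ (g' j) 0 ∧ IndepLast m (g' j)) →
        ((f : Filter.Germ (𝓝 (0 : Fin (m + 1) → ℂ)) F) =
          ↑(fun z => (z (Fin.last m) ^ d
              + ∑ j : Fin d, a j z * z (Fin.last m) ^ (j : ℕ)) • g₀ z
              + ∑ j : Fin d, z (Fin.last m) ^ (j : ℕ) • g' j z)) →
        (↑f₀ : Filter.Germ (𝓝 (0 : Fin (m + 1) → ℂ)) F) = ↑g₀ ∧
          ∀ j, (↑(f' j) : Filter.Germ (𝓝 (0 : Fin (m + 1) → ℂ)) F) = ↑(g' j) := by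
  obtain ⟨fn, hfn, hf⟩ := f.2
  rw [hf]
  obtain ⟨f₀, f', hf₀, hf', hdiv⟩ :=
    (boundedShiftModel F).exists_division (fun j => ha j) hfn
  refine ⟨f₀, f', hf₀, hf', Filter.Germ.coe_eq.2 hdiv, fun g₀ g' hg₀ hg' hg => ?_⟩
  have h := (boundedShiftModel F).division_unique ha (q := fun z => f₀ z - g₀ z)
    (r := fun j z => f' j z - g' j z) (hf₀.sub hg₀)
    (fun j z w hzw => by simp only [(hf' j).2 z w hzw, (hg' j).2 z w hzw]) (by
      filter_upwards [hdiv, Filter.Germ.coe_eq.1 hg] with z h1 h2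
      simp only [smul_sub, Finset.sum_sub_distrib]
      rw [sub_add_sub_comm, ← h1, ← h2, sub_self])
  exact ⟨Filter.Germ.coe_eq.2 (h.mono fun z hz => sub_eq_zero.1 hz.1),
    fun j => Filter.Germ.coe_eq.2 (h.mono fun z hz => sub_eq_zero.1 (hz.2 j))⟩
end
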